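/- arXiv:1912.08250 — 6 statements merged into one kernel-verified Lean document; each statement's English description precedes it below -/
import Mathlib

section
/- Let α > 0 and 1 ≤ p < ∞. There exists a constant c > 0 such that for every z ∈ ℂ there exists f ∈ F^p_φ with 0 < ‖f‖_{p,φ} < ∞ and |f(z)| ≥ c (1+|z|)^{−2/p} e^{φ(z)} ‖f‖_{p,φ}. In particular, the norm of the point evaluation functional L_z : f ↦ f(z) on F^p_φ is bounded below by c (1+|z|)^{−2/p} e^{φ(z)}. -/
open MeasureTheory Complex
open scoped ENNReal

noncomputable section

/-- `log⁺ t = max (log t) 0`. -/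
def logPlus (t : ℝ) : ℝ := max (Real.log t) 0

/-- The weight `φ(z) = α (log⁺ |z|)²`. -/
def phi (α : ℝ) (z : ℂ) : ℝ := α * (logPlus ‖z‖) ^ 2

/-- `‖f‖_{p,φ}^p = ∫_ℂ |f(z) e^{-φ(z)}|^p dm(z)` as an extended nonnegative real. -/
def fockNormP (α p : ℝ) (f : ℂ → ℂ) : ℝ≥0∞ :=
  ∫⁻ z : ℂ, ENNReal.ofReal ((‖f z‖ * Real.exp (-(phi α z))) ^ p)

/-- Membership in the Fock space `F^p_φ`: entire and finite norm. -/
def MemFock (α p : ℝ) (f : ℂ → ℂ) : Prop :=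
  Differentiable ℂ f ∧ fockNormP α p f < ⊤

theorem key_bound (α : ℝ) (hα : 0 < α) (t : ℝ) (ht : 0 ≤ t) (n : ℕ)
    (h1 : (n : ℝ) ≤ 2 * α * t) (h2 : 2 * α * t < n + 1) (w : ℂ) :
    ‖w ^ n‖ * Real.exp (-(phi α w)) ≤
      (8 * Real.exp (4 / α)) * Real.exp (n * t - α * t ^ 2) *
        ((1 + ‖(Real.exp t)⁻¹ • w‖) ^ 3)⁻¹ := by
  have hx : ‖(Real.exp t)⁻¹ • w‖ = Real.exp (-t) * ‖w‖ := by
    rw [norm_smul, Real.norm_eq_abs, ← Real.exp_neg, abs_of_pos (Real.exp_pos _)]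
  rw [hx, ← div_eq_mul_inv, le_div_iff₀ (by positivity)]
  have hq : ∀ v : ℝ, 4 * v - α * v ^ 2 ≤ 4 / α := by
    intro v
    rw [le_div_iff₀ hα]
    nlinarith [sq_nonneg (α * v - 2)]
  by_cases hw : 1 ≤ ‖w‖
  · have hw0 : 0 < ‖w‖ := by linarith
    have hs : 0 ≤ Real.log ‖w‖ := Real.log_nonneg hw
    have hphi : phi α w = α * (Real.log ‖w‖) ^ 2 := by
      simp only [phi, logPlus, max_eq_left hs]
    rw [hphi, norm_pow]
    set s := Real.log ‖w‖ with hsdef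
    have hws : ‖w‖ = Real.exp s := (Real.exp_log hw0).symm
    rw [hws, ← Real.exp_nat_mul, ← Real.exp_add, ← Real.exp_add]
    have hb : 1 + Real.exp (-t + s) ≤ 2 * Real.exp |s - t| := by
      have e1 : Real.exp (-t + s) ≤ Real.exp |s - t| :=
        Real.exp_le_exp.2 (by have := le_abs_self (s - t); linarith)
      have e2 : 1 ≤ Real.exp |s - t| := Real.one_le_exp (abs_nonneg _)
      linarith
    have hc : (1 + Real.exp (-t + s)) ^ 3 ≤ 8 * Real.exp (3 * |s - t|) := by
      calc (1 + Real.exp (-t + s)) ^ 3 ≤ (2 * Real.exp |s - t|) ^ 3 := by gcongr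
        _ = 8 * Real.exp (3 * |s - t|) := by
          rw [mul_pow, ← Real.exp_nat_mul]; norm_num
    have hd : (n - 2 * α * t) * (s - t) ≤ |s - t| := by
      have : |(n - 2 * α * t)| ≤ 1 := by rw [abs_le]; constructor <;> linarith
      calc (n - 2 * α * t) * (s - t) ≤ |(n - 2 * α * t) * (s - t)| := le_abs_self _
        _ = |(n - 2 * α * t)| * |s - t| := abs_mul _ _
        _ ≤ 1 * |s - t| := by gcongr
        _ = _ := one_mul _
    calc _ ≤ Real.exp (n * s + -(α * s ^ 2)) * (8 * Real.exp (3 * |s - t|)) := by gcongr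
      _ = 8 * Real.exp (n * s + -(α * s ^ 2) + 3 * |s - t|) := by
        rw [Real.exp_add (n * s + -(α * s ^ 2))]; ring
      _ ≤ 8 * Real.exp (4 / α + (n * t - α * t ^ 2)) := by
        have h := hq |s - t|
        rw [sq_abs] at h
        refine mul_le_mul_of_nonneg_left (Real.exp_le_exp.2 ?_) (by norm_num)
        nlinarith
      _ = _ := by rw [Real.exp_add]; ring
  · push Not at hw
    have hl : ‖w ^ n‖ * Real.exp (-(phi α w)) ≤ 1 := by
      have a1 : ‖w ^ n‖ ≤ 1 := by rw [norm_pow]; exact pow_le_one₀ (norm_nonneg _) hw.le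
      have a2 : Real.exp (-(phi α w)) ≤ 1 := by
        rw [Real.exp_le_one_iff, neg_nonpos]; unfold phi; positivity
      exact mul_le_one₀ a1 (Real.exp_pos _).le a2
    have hm : Real.exp (-t) * ‖w‖ ≤ 1 :=
      mul_le_one₀ (Real.exp_le_one_iff.2 (by linarith)) (norm_nonneg _) hw.le
    have hc : (1 + Real.exp (-t) * ‖w‖) ^ 3 ≤ 8 := by
      calc (1 + Real.exp (-t) * ‖w‖) ^ 3 ≤ (1 + 1) ^ 3 := by gcongr
        _ = 8 := by norm_num
    have he : 1 ≤ Real.exp (4 / α + (n * t - α * t ^ 2)) := by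
      apply Real.one_le_exp
      have := hq t
      nlinarith
    calc _ ≤ 1 * (8 : ℝ) := by gcongr
      _ ≤ 8 * Real.exp (4 / α + (n * t - α * t ^ 2)) := by linarith
      _ = _ := by rw [Real.exp_add]; ring

/-- there is a constant `c > 0` such that for every `z ∈ ℂ` there is
`f ∈ F^p_φ` with `0 < ‖f‖_{p,φ} < ∞` and `|f(z)| ≥ c (1+|z|)^{-2/p} e^{φ(z)} ‖f‖_{p,φ}`;
in particular the norm of the evaluation functional `L_z` is at least
`c (1+|z|)^{-2/p} e^{φ(z)}`. -/
theorem statement6 (α p : ℝ) (hα : 0 < α) (hp : 1 ≤ p) :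
    ∃ c : ℝ, 0 < c ∧ ∀ z : ℂ, ∃ f : ℂ → ℂ, MemFock α p f ∧
      0 < ((fockNormP α p f).toReal) ^ (1 / p) ∧
      c * (1 + ‖z‖) ^ (-(2 / p)) * Real.exp (phi α z) *
          ((fockNormP α p f).toReal) ^ (1 / p) ≤ ‖f z‖ := by
  have hp0 : 0 < p := by linarith
  set g : ℂ → ℝ := fun v => (1 + ‖v‖) ^ (-(3 * p)) with hg
  have hgi : Integrable g := by
    apply integrable_one_add_norm
    rw [Complex.finrank_real_complex]; push_cast; linarith
  have hg0 : ∀ v, 0 ≤ g v := fun v => by simp only [hg]; positivity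
  set I : ℝ := (∫ v, g v) + 1 with hI
  have hI0 : 0 < I := by have : 0 ≤ ∫ v, g v := integral_nonneg hg0; simp only [hI]; linarith
  set K : ℝ := 8 * Real.exp (4 / α) with hK
  have hK0 : 0 < K := by positivity
  refine ⟨(K * I ^ (1 / p))⁻¹, by positivity, fun z => ?_⟩
  set t : ℝ := logPlus ‖z‖ with ht
  have ht0 : 0 ≤ t := le_max_right _ _
  set n : ℕ := ⌊2 * α * t⌋₊ with hn
  have h1 : (n : ℝ) ≤ 2 * α * t := Nat.floor_le (by positivity)
  have h2 : 2 * α * t < n + 1 := Nat.lt_floor_add_one _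
  set A : ℝ := Real.exp (n * t - α * t ^ 2) with hA
  have hA0 : 0 < A := Real.exp_pos _
  have hgs : Integrable (fun w : ℂ => (K * A) ^ p * g ((Real.exp t)⁻¹ • w)) :=
    (hgi.comp_smul (by positivity)).const_mul _
  have hint : ∫ w : ℂ, (K * A) ^ p * g ((Real.exp t)⁻¹ • w)
      = (K * A) ^ p * (Real.exp t ^ 2 * ∫ v, g v) := by
    rw [integral_const_mul, Measure.integral_comp_smul, Complex.finrank_real_complex,
      inv_pow, inv_inv, abs_of_pos (by positivity), smul_eq_mul]
  have hle : fockNormP α p (fun w => w ^ n) ≤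
      ENNReal.ofReal ((K * A) ^ p * (Real.exp t ^ 2 * ∫ v, g v)) := by
    rw [← hint, ofReal_integral_eq_lintegral_ofReal hgs
      (Filter.Eventually.of_forall fun w => mul_nonneg (by positivity) (hg0 _))]
    apply lintegral_mono
    intro w
    apply ENNReal.ofReal_le_ofReal
    calc _ ≤ (K * A * ((1 + ‖(Real.exp t)⁻¹ • w‖) ^ 3)⁻¹) ^ p :=
          Real.rpow_le_rpow (by positivity) (key_bound α hα t ht0 n h1 h2 w) hp0.le
      _ = _ := by
        rw [Real.mul_rpow (by positivity) (by positivity)]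
        congr 1
        simp only [hg]
        rw [← Real.rpow_natCast, ← Real.rpow_neg (by positivity), ← Real.rpow_mul (by positivity)]
        congr 1; push_cast; ring
  have hfin : fockNormP α p (fun w => w ^ n) < ⊤ := hle.trans_lt ENNReal.ofReal_lt_top
  have hpos : fockNormP α p (fun w => w ^ n) ≠ 0 := by
    intro h0
    unfold fockNormP at h0
    rw [lintegral_eq_zero_iff (by unfold phi logPlus; fun_prop)] at h0
    have hne : ∀ᵐ w : ℂ, w ≠ 0 := by
      simp [ae_iff]
    obtain ⟨w, hw, hw0⟩ := (h0.and hne).exists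
    have : 0 < (‖w ^ n‖ * Real.exp (-(phi α w))) ^ p := by
      have : 0 < ‖w ^ n‖ := norm_pos_iff.2 (pow_ne_zero _ hw0)
      positivity
    have h3 := ENNReal.ofReal_pos.2 this
    exact h3.ne' hw
  have hX0 : 0 < (fockNormP α p (fun w => w ^ n)).toReal := ENNReal.toReal_pos hpos hfin.ne
  refine ⟨fun w => w ^ n, ⟨differentiable_id.pow n, hfin⟩, by positivity, ?_⟩
  have hX : (fockNormP α p (fun w => w ^ n)).toReal ≤ (K * A) ^ p * (Real.exp t ^ 2 * I) := by
    apply ENNReal.toReal_le_of_le_ofReal (by positivity)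
    refine hle.trans (ENNReal.ofReal_le_ofReal ?_)
    gcongr
    simp only [hI]; linarith
  have hrt : Real.exp t ≤ 1 + ‖z‖ := by
    rcases le_total (Real.log ‖z‖) 0 with h | h
    · have : t = 0 := max_eq_right h
      rw [this, Real.exp_zero]; linarith [norm_nonneg z]
    · have h' : t = Real.log ‖z‖ := max_eq_left h
      rcases (norm_nonneg z).eq_or_lt with h0 | h0
      · rw [h', ← h0]; simp
      · rw [h', Real.exp_log h0]; linarith
  have hfz : ‖z ^ n‖ = Real.exp (n * t) := by
    rw [norm_pow]
    rcases le_or_gt (Real.log ‖z‖) 0 with h | h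
    · have h' : t = 0 := max_eq_right h
      have : n = 0 := by rw [hn, h']; simp
      rw [this]; simp
    · have h' : t = Real.log ‖z‖ := max_eq_left h.le
      have h0 : 0 < ‖z‖ := by
        rcases (norm_nonneg z).eq_or_lt with h0 | h0
        · rw [← h0] at h; simp at h
        · exact h0
      rw [Real.exp_nat_mul, h', Real.exp_log h0]
  have hroot : (fockNormP α p (fun w => w ^ n)).toReal ^ (1 / p)
      ≤ K * A * ((1 + ‖z‖) ^ (2 / p) * I ^ (1 / p)) := by
    calc _ ≤ ((K * A) ^ p * ((1 + ‖z‖) ^ 2 * I)) ^ (1 / p) := by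
          apply Real.rpow_le_rpow hX0.le _ (by positivity)
          refine hX.trans ?_
          gcongr
      _ = _ := by
        rw [Real.mul_rpow (by positivity) (by positivity), Real.mul_rpow (by positivity) hI0.le,
          ← Real.rpow_mul (by positivity), ← Real.rpow_natCast (1 + ‖z‖) 2,
          ← Real.rpow_mul (by positivity), mul_one_div_cancel hp0.ne', Real.rpow_one]
        congr 3; push_cast; ring
  have hphi : phi α z = α * t ^ 2 := rfl
  show _ ≤ ‖z ^ n‖
  rw [hfz, hphi]
  calc _ ≤ (K * I ^ (1 / p))⁻¹ * (1 + ‖z‖) ^ (-(2 / p)) * Real.exp (α * t ^ 2) *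
        (K * A * ((1 + ‖z‖) ^ (2 / p) * I ^ (1 / p))) := by gcongr
    _ = Real.exp (α * t ^ 2) * A := by
      have hJ : I ^ (1 / p) ≠ 0 := by positivity
      have hZ : (1 + ‖z‖) ^ (2 / p) ≠ 0 := by positivity
      rw [Real.rpow_neg (by positivity)]
      field_simp
    _ = Real.exp (n * t) := by
      rw [hA, ← Real.exp_add]; congr 1; ring

end
end

section
/- Let l ∈ {−1, 0, 1}. The infinite product G_{Λ_l}(z) := ∏_{n≥l} (1 − z/λ_n) converges uniformly on compact subsets of ℂ and hence defines an entire function, and there exists a constant C ≥ 1 such that for every z ∈ ℂ one has C^{−1} · dist(z, Λ_l)/(1 + |z|^{3/2+l}) ≤ |G_{Λ_l}(z)| e^{−φ(z)} ≤ C · dist(z, Λ_l)/(1 + |z|^{3/2+l}). -/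
open MeasureTheory Complex
open scoped ENNReal

noncomputable section

/-- The weight `φ(z) = (log⁺ |z|)²` (the case `α = 1`). -/
def phi1 (z : ℂ) : ℝ := (logPlus ‖z‖) ^ 2

/-- The point `λ_n = e^{(1+n)/2} e^{iθ_n}`. -/
def lamPt (θ : ℤ → ℝ) (n : ℤ) : ℂ :=
  (Real.exp ((1 + (n : ℝ)) / 2) : ℂ) * Complex.exp ((θ n : ℂ) * Complex.I)

/-- The set `Λ_l = {λ_n : n ≥ l}`. -/
def LamSet (θ : ℤ → ℝ) (l : ℤ) : Set ℂ := {w : ℂ | ∃ n : ℤ, l ≤ n ∧ w = lamPt θ n}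

def qq : ℝ := Real.exp (-(1 / 4))
def bb : ℝ := Real.exp (-(1 / 2))
def AA : ℝ := (1 / (1 - qq)) * (qq * (1 / (1 - bb)))

lemma qq_pos : 0 < qq := Real.exp_pos _
lemma qq_lt : qq < 1 := by unfold qq; rw [Real.exp_lt_one_iff]; norm_num
lemma bb_pos : 0 < bb := Real.exp_pos _
lemma bb_lt : bb < 1 := by unfold bb; rw [Real.exp_lt_one_iff]; norm_num

lemma lower_exp {x : ℝ} (h0 : 0 ≤ x) (h1 : x ≤ qq) :
    Real.exp (-((1 / (1 - qq)) * x)) ≤ 1 - x := by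
  have hq := qq_lt
  have hx : 0 < 1 - x := by linarith
  have h2 : 1 + x / (1 - x) ≤ Real.exp (x / (1 - x)) := by
    have := Real.add_one_le_exp (x / (1 - x)); linarith
  have h3 : 1 + x / (1 - x) = (1 - x)⁻¹ := by field_simp; ring
  have h4 : x / (1 - x) ≤ (1 / (1 - qq)) * x := by
    rw [div_eq_mul_one_div, mul_comm]
    apply mul_le_mul_of_nonneg_right _ h0
    apply one_div_le_one_div_of_le <;> linarith
  rw [Real.exp_neg]
  apply inv_le_of_inv_le₀ hx
  rw [← h3]
  exact h2.trans (Real.exp_le_exp.2 h4)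

lemma sum_bound (m : ℕ) :
    ∑ j ∈ Finset.range m, (1 / (1 - qq)) * (qq * bb ^ j) ≤ AA := by
  have hq := qq_lt
  have hq0 := qq_pos
  rw [← Finset.mul_sum, ← Finset.mul_sum]
  unfold AA
  have h : ∑ j ∈ Finset.range m, bb ^ j ≤ 1 / (1 - bb) := by
    rw [one_div, ← tsum_geometric_of_lt_one bb_pos.le bb_lt]
    exact (summable_geometric_of_lt_one bb_pos.le bb_lt).sum_le_tsum _
      (fun i _ => pow_nonneg bb_pos.le i)
  have : 0 ≤ 1 / (1 - qq) := by apply one_div_nonneg.2; linarith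
  gcongr

lemma prod_bound (m : ℕ) (u : ℕ → ℂ) (hu : ∀ j < m, ‖u j‖ ≤ qq * bb ^ j) :
    Real.exp (-AA) ≤ ∏ j ∈ Finset.range m, ‖1 - u j‖ ∧
    ∏ j ∈ Finset.range m, ‖1 - u j‖ ≤ Real.exp AA := by
  have hq := qq_lt
  have hq0 := qq_pos
  have hK : 1 ≤ 1 / (1 - qq) := by
    rw [le_div_iff₀] <;> linarith
  constructor
  · calc Real.exp (-AA) ≤ Real.exp (∑ j ∈ Finset.range m, -((1 / (1 - qq)) * (qq * bb ^ j))) := by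
          apply Real.exp_le_exp.2
          rw [Finset.sum_neg_distrib]
          linarith [sum_bound m]
      _ = ∏ j ∈ Finset.range m, Real.exp (-((1 / (1 - qq)) * (qq * bb ^ j))) := Real.exp_sum _ _
      _ ≤ _ := by
          apply Finset.prod_le_prod
          · intro i _; positivity
          · intro j hj
            have hj' := hu j (Finset.mem_range.1 hj)
            have hb : bb ^ j ≤ 1 := pow_le_one₀ bb_pos.le bb_lt.le
            have h1 : qq * bb ^ j ≤ qq := by nlinarith
            have h2 := lower_exp (mul_nonneg hq0.le (pow_nonneg bb_pos.le j)) h1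
            have h3 : ‖(1:ℂ)‖ - ‖u j‖ ≤ ‖1 - u j‖ := norm_sub_norm_le _ _
            rw [norm_one] at h3
            linarith
  · calc ∏ j ∈ Finset.range m, ‖1 - u j‖
        ≤ ∏ j ∈ Finset.range m, Real.exp ((1 / (1 - qq)) * (qq * bb ^ j)) := by
          apply Finset.prod_le_prod
          · intro i _; positivity
          · intro j hj
            have hj' := hu j (Finset.mem_range.1 hj)
            have h3 : ‖1 - u j‖ ≤ ‖(1:ℂ)‖ + ‖u j‖ := norm_sub_le _ _
            rw [norm_one] at h3
            have h4 := Real.add_one_le_exp ((1 / (1 - qq)) * (qq * bb ^ j))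
            have h5 : 0 ≤ qq * bb ^ j := mul_nonneg hq0.le (pow_nonneg bb_pos.le j)
            nlinarith
      _ = Real.exp (∑ j ∈ Finset.range m, (1 / (1 - qq)) * (qq * bb ^ j)) :=
          (Real.exp_sum _ _).symm
      _ ≤ _ := Real.exp_le_exp.2 (sum_bound m)

lemma norm_lamPt (θ : ℤ → ℝ) (n : ℤ) : ‖lamPt θ n‖ = Real.exp ((1 + (n : ℝ)) / 2) := by
  unfold lamPt
  rw [norm_mul, Complex.norm_exp_ofReal_mul_I, mul_one, Complex.norm_real, Real.norm_eq_abs,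
    abs_of_pos (Real.exp_pos _)]

lemma qb_eq (j : ℕ) : qq * bb ^ j = Real.exp (-(1 / 4) - (j : ℝ) / 2) := by
  unfold qq bb
  rw [← Real.exp_nat_mul, ← Real.exp_add]
  congr 1; ring

lemma lamPt_ne (θ : ℤ → ℝ) (n : ℤ) : lamPt θ n ≠ 0 := by
  rw [← norm_pos_iff, norm_lamPt]; exact Real.exp_pos _

/-- choice of the nearest index -/
lemma exists_index (l : ℤ) (z : ℂ) :
    ∃ k : ℕ, (z ≠ 0 ∧ |Real.log ‖z‖ - (1 + (l : ℝ) + k) / 2| ≤ 1 / 4) ∨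
      (k = 0 ∧ ‖z‖ ≤ Real.exp ((1 + (l : ℝ)) / 2 - 1 / 4)) := by
  by_cases h : ‖z‖ ≤ Real.exp ((1 + (l : ℝ)) / 2 - 1 / 4)
  · exact ⟨0, Or.inr ⟨rfl, h⟩⟩
  · push Not at h
    have hz : 0 < ‖z‖ := (Real.exp_pos _).trans h
    have ht : (1 + (l : ℝ)) / 2 - 1 / 4 < Real.log ‖z‖ := (Real.lt_log_iff_exp_lt hz).2 h
    set t := Real.log ‖z‖
    refine ⟨⌊2 * t - l - 1 / 2⌋₊, Or.inl ⟨norm_pos_iff.1 hz, ?_⟩⟩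
    have h1 := Nat.floor_le (show 0 ≤ 2 * t - l - 1 / 2 by linarith)
    have h2 := Nat.lt_floor_add_one (2 * t - l - 1 / 2)
    rw [abs_le]
    constructor <;> linarith

lemma z_le {l : ℤ} {z : ℂ} {k : ℕ}
    (h : (z ≠ 0 ∧ |Real.log ‖z‖ - (1 + (l : ℝ) + k) / 2| ≤ 1 / 4) ∨
      (k = 0 ∧ ‖z‖ ≤ Real.exp ((1 + (l : ℝ)) / 2 - 1 / 4))) :
    ‖z‖ ≤ Real.exp ((1 + (l : ℝ) + k) / 2 + 1 / 4) := by
  rcases h with ⟨h1, h2⟩ | ⟨h1, h2⟩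
  · rw [← Real.log_le_iff_le_exp (norm_pos_iff.2 h1)]
    rw [abs_le] at h2; linarith
  · refine h2.trans (Real.exp_le_exp.2 ?_)
    subst h1; push_cast; linarith

lemma z_ge {l : ℤ} {z : ℂ} {k : ℕ} (hk : 0 < k)
    (h : (z ≠ 0 ∧ |Real.log ‖z‖ - (1 + (l : ℝ) + k) / 2| ≤ 1 / 4) ∨
      (k = 0 ∧ ‖z‖ ≤ Real.exp ((1 + (l : ℝ)) / 2 - 1 / 4))) :
    Real.exp ((1 + (l : ℝ) + k) / 2 - 1 / 4) ≤ ‖z‖ := by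
  rcases h with ⟨h1, h2⟩ | ⟨h1, h2⟩
  · rw [← Real.le_log_iff_exp_le (norm_pos_iff.2 h1)]
    rw [abs_le] at h2; linarith
  · omega

lemma dist_bound (l : ℤ) (θ : ℤ → ℝ) {z : ℂ} {k : ℕ}
    (h : (z ≠ 0 ∧ |Real.log ‖z‖ - (1 + (l : ℝ) + k) / 2| ≤ 1 / 4) ∨
      (k = 0 ∧ ‖z‖ ≤ Real.exp ((1 + (l : ℝ)) / 2 - 1 / 4))) :
    Metric.infDist z (LamSet θ l) ≤ ‖z - lamPt θ (l + k)‖ ∧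
    ‖z - lamPt θ (l + k)‖ ≤ 3 / (1 - qq) * Metric.infDist z (LamSet θ l) := by
  have hq := qq_lt
  have hq0 := qq_pos
  have hmem : lamPt θ (l + k) ∈ LamSet θ l := ⟨l + k, by omega, rfl⟩
  constructor
  · rw [← dist_eq_norm]; exact Metric.infDist_le_dist_of_mem hmem
  · have key : (1 - qq) / 3 * ‖z - lamPt θ (l + k)‖ ≤ Metric.infDist z (LamSet θ l) := by
      rw [Metric.le_infDist ⟨_, hmem⟩]
      rintro w ⟨n, hn, rfl⟩
      obtain ⟨j, rfl⟩ : ∃ j : ℕ, n = l + j := ⟨(n - l).toNat, by omega⟩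
      rw [dist_eq_norm]
      have h0 := norm_nonneg (z - lamPt θ (l + k))
      have hA : ‖z - lamPt θ (l + k)‖ ≤ ‖z‖ + ‖lamPt θ (l + k)‖ := norm_sub_le _ _
      rcases lt_trichotomy j k with hjk | hjk | hjk
      · have hg := z_ge (by omega) h
        have h1 : ‖lamPt θ (l + j)‖ ≤ qq * ‖z‖ := by
          refine le_trans ?_ (mul_le_mul_of_nonneg_left hg hq0.le)
          rw [norm_lamPt, qq, ← Real.exp_add]
          apply Real.exp_le_exp.2
          have : (j : ℝ) + 1 ≤ k := by exact_mod_cast hjk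
          push_cast; linarith
        have h2 : ‖lamPt θ (l + k)‖ ≤ 2 * ‖z‖ := by
          refine le_trans ?_ (mul_le_mul_of_nonneg_left hg two_pos.le)
          have h4 : Real.exp (1 / 4) ≤ 2 := by
            rw [← Real.le_log_iff_exp_le two_pos]
            linarith [Real.log_two_gt_d9]
          refine le_trans ?_ (mul_le_mul_of_nonneg_right h4 (Real.exp_pos _).le)
          rw [norm_lamPt, ← Real.exp_add]
          apply Real.exp_le_exp.2
          push_cast; linarith
        have h3 : ‖z‖ - ‖lamPt θ (l + j)‖ ≤ ‖z - lamPt θ (l + j)‖ := norm_sub_norm_le _ _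
        nlinarith
      · subst hjk; nlinarith
      · have hg := z_le h
        have hc : (k : ℝ) + 1 ≤ j := by exact_mod_cast hjk
        have h1 : ‖z‖ ≤ qq * ‖lamPt θ (l + j)‖ := by
          refine hg.trans ?_
          rw [norm_lamPt, qq, ← Real.exp_add]
          apply Real.exp_le_exp.2
          push_cast; linarith
        have h2 : ‖lamPt θ (l + k)‖ ≤ ‖lamPt θ (l + j)‖ := by
          rw [norm_lamPt, norm_lamPt]
          apply Real.exp_le_exp.2
          push_cast; linarith
        have h3 : ‖lamPt θ (l + j)‖ - ‖z‖ ≤ ‖z - lamPt θ (l + j)‖ := by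
          rw [norm_sub_rev]; exact norm_sub_norm_le _ _
        have h5 := norm_nonneg (lamPt θ (l + j))
        have h6 : qq * ‖lamPt θ (l + j)‖ ≤ ‖lamPt θ (l + j)‖ :=
          mul_le_of_le_one_left h5 hq.le
        have h7 : ‖z - lamPt θ (l + k)‖ ≤ 3 * ‖lamPt θ (l + j)‖ := by linarith
        have h8 := mul_le_mul_of_nonneg_left h7 (show 0 ≤ (1 - qq) / 3 by linarith)
        linarith
    have : ‖z - lamPt θ (l + k)‖ = 3 / (1 - qq) * ((1 - qq) / 3 * ‖z - lamPt θ (l + k)‖) := by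
      have : 1 - qq ≠ 0 := by linarith
      field_simp
    rw [this]
    apply mul_le_mul_of_nonneg_left key
    apply div_nonneg <;> linarith

/-- the main term -/
def VV (l : ℤ) (r : ℝ) (k : ℕ) : ℝ :=
  (∏ j ∈ Finset.range k, (r / Real.exp ((1 + (l : ℝ) + j) / 2))) /
    Real.exp ((1 + (l : ℝ) + k) / 2)

lemma partial_bound (l : ℤ) (θ : ℤ → ℝ) {z : ℂ} {k : ℕ}
    (h : (z ≠ 0 ∧ |Real.log ‖z‖ - (1 + (l : ℝ) + k) / 2| ≤ 1 / 4) ∨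
      (k = 0 ∧ ‖z‖ ≤ Real.exp ((1 + (l : ℝ)) / 2 - 1 / 4))) (m : ℕ) :
    Real.exp (-(2 * AA)) * (VV l ‖z‖ k * ‖z - lamPt θ (l + k)‖) ≤
      ‖∏ j ∈ Finset.range (k + 1 + m), (1 - z / lamPt θ (l + j))‖ ∧
    ‖∏ j ∈ Finset.range (k + 1 + m), (1 - z / lamPt θ (l + j))‖ ≤
      Real.exp (2 * AA) * (VV l ‖z‖ k * ‖z - lamPt θ (l + k)‖) := by
  -- tail
  have hT := prod_bound m (fun j => z / lamPt θ (l + (k + 1 + j : ℕ))) (by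
    intro j _
    rw [norm_div, norm_lamPt, div_le_iff₀ (Real.exp_pos _), qb_eq, ← Real.exp_add]
    refine (z_le h).trans (Real.exp_le_exp.2 ?_)
    push_cast; linarith)
  have hH := prod_bound k (fun j => lamPt θ (l + (k - 1 - j : ℕ)) / z) (by
    intro j hj
    have hg := z_ge (by omega) h
    rw [norm_div, norm_lamPt, div_le_iff₀ ((Real.exp_pos _).trans_le hg), qb_eq]
    refine le_trans ?_ (mul_le_mul_of_nonneg_left hg (Real.exp_pos _).le)
    rw [← Real.exp_add]
    apply Real.exp_le_exp.2
    have : ((k - 1 - j : ℕ) : ℝ) = k - 1 - j := by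
      rw [Nat.sub_sub, Nat.cast_sub (by omega)]; push_cast; ring
    push_cast [this]; linarith)
  rw [Finset.prod_range_reflect (fun i => ‖1 - lamPt θ (l + (i : ℕ)) / z‖)] at hH
  have heq : ‖∏ j ∈ Finset.range (k + 1 + m), (1 - z / lamPt θ (l + j))‖ =
      (VV l ‖z‖ k * ‖z - lamPt θ (l + k)‖) *
      ((∏ j ∈ Finset.range k, ‖1 - lamPt θ (l + (j : ℕ)) / z‖) *
       ∏ j ∈ Finset.range m, ‖1 - z / lamPt θ (l + (k + 1 + j : ℕ))‖) := by
    rw [Finset.prod_range_add, Finset.prod_range_succ, norm_mul, norm_mul, norm_prod, norm_prod]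
    have e1 : ∏ j ∈ Finset.range k, ‖1 - z / lamPt θ (l + j)‖ =
        (∏ j ∈ Finset.range k, (‖z‖ / Real.exp ((1 + (l : ℝ) + j) / 2))) *
        ∏ j ∈ Finset.range k, ‖1 - lamPt θ (l + (j : ℕ)) / z‖ := by
      rw [← Finset.prod_mul_distrib]
      apply Finset.prod_congr rfl
      intro j hj
      have hk : 0 < k := by have := Finset.mem_range.1 hj; omega
      have hz : z ≠ 0 := norm_pos_iff.1 ((Real.exp_pos _).trans_le (z_ge hk h))
      have hl := lamPt_ne θ (l + j)
      have : ‖z‖ / Real.exp ((1 + (l : ℝ) + j) / 2) = ‖z / lamPt θ (l + j)‖ := by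
        rw [norm_div, norm_lamPt]; push_cast; congr 3; ring
      rw [this, ← norm_mul, ← norm_neg]
      congr 1
      field_simp
      ring
    have e2 : ‖1 - z / lamPt θ (l + k)‖ =
        ‖z - lamPt θ (l + k)‖ / Real.exp ((1 + (l : ℝ) + k) / 2) := by
      have hl := lamPt_ne θ (l + k)
      have : Real.exp ((1 + (l : ℝ) + k) / 2) = ‖lamPt θ (l + k)‖ := by
        rw [norm_lamPt]; push_cast; congr 2; ring
      rw [this, ← norm_div, ← norm_neg]
      congr 1
      field_simp
      ring
    rw [e1, e2, VV]
    ring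
  have hV : 0 ≤ VV l ‖z‖ k * ‖z - lamPt θ (l + k)‖ := by
    unfold VV; positivity
  rw [heq]
  constructor
  · rw [mul_comm]
    apply mul_le_mul_of_nonneg_left _ hV
    have : Real.exp (-(2 * AA)) = Real.exp (-AA) * Real.exp (-AA) := by
      rw [← Real.exp_add]; congr 1; ring
    rw [this]
    exact mul_le_mul hH.1 hT.1 (Real.exp_pos _).le ((Real.exp_pos _).le.trans hH.1)
  · rw [mul_comm]
    apply mul_le_mul_of_nonneg_right _ hV
    have : Real.exp (2 * AA) = Real.exp AA * Real.exp AA := by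
      rw [← Real.exp_add]; congr 1; ring
    rw [this]
    exact mul_le_mul hH.2 hT.2 (Finset.prod_nonneg fun _ _ => norm_nonneg _) (Real.exp_pos _).le

lemma VV_exp (l : ℤ) (t : ℝ) (k : ℕ) :
    VV l (Real.exp t) k =
      Real.exp (k * t - k * (1 + l) / 2 - k * (k - 1) / 4 - (1 + (l : ℝ) + k) / 2) := by
  unfold VV
  rw [Real.exp_sub _ ((1 + (l : ℝ) + k) / 2)]
  congr 1
  induction k with
  | zero => simp
  | succ n ih =>
    rw [Finset.prod_range_succ, ih, ← Real.exp_sub, ← Real.exp_add]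
    congr 1; push_cast; ring

lemma main_term (l : ℤ) (hl : l = -1 ∨ l = 0 ∨ l = 1) {z : ℂ} {k : ℕ}
    (h : (z ≠ 0 ∧ |Real.log ‖z‖ - (1 + (l : ℝ) + k) / 2| ≤ 1 / 4) ∨
      (k = 0 ∧ ‖z‖ ≤ Real.exp ((1 + (l : ℝ)) / 2 - 1 / 4))) :
    Real.exp (-6) ≤ VV l ‖z‖ k * Real.exp (-(phi1 z)) * (1 + ‖z‖ ^ (3 / 2 + (l : ℝ))) ∧
    VV l ‖z‖ k * Real.exp (-(phi1 z)) * (1 + ‖z‖ ^ (3 / 2 + (l : ℝ))) ≤ Real.exp 6 := by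
  have hl1 : (-1 : ℝ) ≤ l := by rcases hl with rfl | rfl | rfl <;> norm_num
  have hl2 : (l : ℝ) ≤ 1 := by rcases hl with rfl | rfl | rfl <;> norm_num
  have he : 2 ≤ Real.exp 1 := by have := Real.add_one_le_exp (1 : ℝ); linarith
  rcases h with ⟨hz, h⟩ | ⟨rfl, h⟩
  · have hz' : 0 < ‖z‖ := norm_pos_iff.2 hz
    unfold phi1 logPlus
    obtain ⟨t, ht⟩ : ∃ t, t = Real.log ‖z‖ := ⟨_, rfl⟩
    have hr : ‖z‖ = Real.exp t := by rw [ht, Real.exp_log hz']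
    rw [← ht] at h ⊢
    rw [hr, VV_exp, ← Real.exp_mul]
    rw [abs_le] at h
    obtain ⟨δ, hδ⟩ : ∃ δ, δ = t - (1 + (l : ℝ) + k) / 2 := ⟨_, rfl⟩
    rw [← hδ] at h
    have hk : (k : ℝ) = 2 * t - 1 - l - 2 * δ := by linarith
    have hk0 : (0 : ℝ) ≤ k := k.cast_nonneg
    have htl : -(1 / 4) ≤ t := by linarith
    have hphi : t ^ 2 - 1 ≤ max t 0 ^ 2 ∧ max t 0 ^ 2 ≤ t ^ 2 := by
      rcases le_total t 0 with h0 | h0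
      · rw [max_eq_right h0]; constructor <;> nlinarith
      · rw [max_eq_left h0]; constructor <;> linarith
    have hW1 : Real.exp (t * (3 / 2 + l)) ≤ 1 + Real.exp (t * (3 / 2 + l)) := by linarith
    have hW2 : 1 + Real.exp (t * (3 / 2 + l)) ≤ Real.exp (2 + t * (3 / 2 + l)) := by
      have a1 : 1 ≤ Real.exp (1 + t * (3 / 2 + l)) := by
        apply Real.one_le_exp; nlinarith
      have a2 : Real.exp (2 + t * (3 / 2 + l)) =
          Real.exp 1 * Real.exp (1 + t * (3 / 2 + l)) := by
        rw [← Real.exp_add]; congr 1; ring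
      have a3 : Real.exp (t * (3 / 2 + l)) ≤ Real.exp (1 + t * (3 / 2 + l)) :=
        Real.exp_le_exp.2 (by linarith)
      rw [a2]; nlinarith
    have hid : (k : ℝ) * t - k * (1 + l) / 2 - k * (k - 1) / 4 - (1 + (l : ℝ) + k) / 2 =
        t ^ 2 - t * (3 / 2 + l) + l * (l + 1) / 4 - δ ^ 2 + δ / 2 := by
      rw [hk]; ring
    rw [hid, ← Real.exp_add]
    have hδ2 : δ ^ 2 ≤ 1 := by nlinarith
    have hδ3 : 0 ≤ δ ^ 2 := sq_nonneg _
    have hll : -1 ≤ (l : ℝ) * (l + 1) / 4 ∧ (l : ℝ) * (l + 1) / 4 ≤ 1 := by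
      constructor <;> nlinarith
    constructor
    · refine le_trans ?_ (mul_le_mul_of_nonneg_left hW1 (Real.exp_pos _).le)
      rw [← Real.exp_add]
      apply Real.exp_le_exp.2
      linarith
    · refine le_trans (mul_le_mul_of_nonneg_left hW2 (Real.exp_pos _).le) ?_
      rw [← Real.exp_add]
      apply Real.exp_le_exp.2
      linarith
  · have hV : VV l ‖z‖ 0 = Real.exp (-((1 + (l : ℝ)) / 2)) := by
      unfold VV; simp [Real.exp_neg]
    rw [hV, ← Real.exp_add]
    have h34 : ‖z‖ ≤ Real.exp 1 := h.trans (Real.exp_le_exp.2 (by linarith))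
    have hphi0 : 0 ≤ phi1 z := sq_nonneg _
    have hphi1 : phi1 z ≤ 1 := by
      unfold phi1 logPlus
      have : max (Real.log ‖z‖) 0 ≤ 1 := by
        apply max_le _ zero_le_one
        rcases (norm_nonneg z).eq_or_lt with h0 | h0
        · rw [← h0]; simp
        · rwa [Real.log_le_iff_le_exp h0]
      exact pow_le_one₀ (le_max_right _ _) this
    have hp0 : 0 ≤ ‖z‖ ^ (3 / 2 + (l : ℝ)) := by positivity
    have hp1 : ‖z‖ ^ (3 / 2 + (l : ℝ)) ≤ Real.exp 3 := by
      calc _ ≤ (Real.exp 1) ^ (3 / 2 + (l : ℝ)) :=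
            Real.rpow_le_rpow (norm_nonneg _) h34 (by linarith)
        _ = Real.exp (1 * (3 / 2 + (l : ℝ))) := by rw [← Real.exp_mul]
        _ ≤ _ := Real.exp_le_exp.2 (by linarith)
    have hW : 1 + ‖z‖ ^ (3 / 2 + (l : ℝ)) ≤ Real.exp 4 := by
      have : Real.exp 4 = Real.exp 1 * Real.exp 3 := by rw [← Real.exp_add]; norm_num
      have h1 : 1 ≤ Real.exp 3 := Real.one_le_exp (by norm_num)
      rw [this]; nlinarith
    constructor
    · refine le_trans ?_ (mul_le_mul_of_nonneg_left (show 1 ≤ _ by linarith) (Real.exp_pos _).le)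
      rw [mul_one]
      apply Real.exp_le_exp.2; linarith
    · refine le_trans (mul_le_mul_of_nonneg_left hW (Real.exp_pos _).le) ?_
      rw [← Real.exp_add]
      apply Real.exp_le_exp.2; linarith

lemma unif_conv (l : ℤ) (θ : ℤ → ℝ) (K : Set ℂ) (hK : IsCompact K) :
    TendstoUniformlyOn
      (fun (m : ℕ) (z : ℂ) => ∏ k ∈ Finset.range m, (1 - z / lamPt θ (l + k)))
      (fun z => ∏' k : ℕ, (1 + -(z / lamPt θ (l + k)))) Filter.atTop K := by
  obtain ⟨R, hR⟩ := hK.isBounded.exists_norm_le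
  have hu : Summable (fun k : ℕ => R * Real.exp (-((1 + (l : ℝ)) / 2)) * bb ^ k) :=
    (summable_geometric_of_lt_one bb_pos.le bb_lt).mul_left _
  have := (hu.hasProdUniformlyOn_nat_one_add (f := fun (k : ℕ) z => -(z / lamPt θ (l + k))) hK
    (Filter.Eventually.of_forall fun k z hz => by
      rw [norm_neg, norm_div, norm_lamPt, div_eq_mul_inv, ← Real.exp_neg, mul_assoc]
      have e : Real.exp (-((1 + (l : ℝ)) / 2)) * bb ^ k =
          Real.exp (-((1 + ((l + k : ℤ) : ℝ)) / 2)) := by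
        unfold bb
        rw [← Real.exp_nat_mul, ← Real.exp_add]
        congr 1; push_cast; ring
      rw [e]
      exact mul_le_mul_of_nonneg_right (hR z hz) (Real.exp_pos _).le)
    (fun k => by fun_prop)).tendstoUniformlyOn_finsetRange
  simpa only [← sub_eq_add_neg] using this

/-- the product `G_{Λ_l}(z) = ∏_{n≥l} (1 - z/λ_n)` converges uniformly on
compact subsets of `ℂ`, defines an entire function, and
`|G_{Λ_l}(z)| e^{-φ(z)} ≍ dist(z, Λ_l)/(1 + |z|^{3/2+l})`. -/
theorem statement7 (l : ℤ) (hl : l = -1 ∨ l = 0 ∨ l = 1) (θ : ℤ → ℝ) :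
    ∃ G : ℂ → ℂ,
      (∀ K : Set ℂ, IsCompact K →
        TendstoUniformlyOn
          (fun (m : ℕ) (z : ℂ) => ∏ k ∈ Finset.range m, (1 - z / lamPt θ (l + k)))
          G Filter.atTop K) ∧
      Differentiable ℂ G ∧
      ∃ C : ℝ, 1 ≤ C ∧ ∀ z : ℂ,
        (1 / C) * (Metric.infDist z (LamSet θ l) /
            (1 + ‖z‖ ^ (3 / 2 + (l : ℝ)))) ≤
          ‖G z‖ * Real.exp (-(phi1 z)) ∧
        ‖G z‖ * Real.exp (-(phi1 z)) ≤
          C * (Metric.infDist z (LamSet θ l) /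
            (1 + ‖z‖ ^ (3 / 2 + (l : ℝ)))) := by
  have hconv := unif_conv l θ
  refine ⟨_, hconv, ?_, ?_⟩
  · rw [← differentiableOn_univ]
    apply TendstoLocallyUniformlyOn.differentiableOn (φ := Filter.atTop)
      ((tendstoLocallyUniformlyOn_iff_forall_isCompact isOpen_univ).2 fun K _ hK => hconv K hK)
      _ isOpen_univ
    refine Filter.Eventually.of_forall fun m => ?_
    fun_prop
  · have hq := qq_lt
    have hq0 := qq_pos
    have hA : 0 ≤ AA := by
      have h1 := bb_lt
      have h2 : 0 < 1 - bb := by linarith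
      have h3 : 0 < 1 - qq := by linarith
      unfold AA; positivity
    have h3 : 1 ≤ 3 / (1 - qq) := by rw [le_div_iff₀] <;> linarith
    have hE : 1 ≤ Real.exp (2 * AA + 6) := Real.one_le_exp (by linarith)
    refine ⟨Real.exp (2 * AA + 6) * (3 / (1 - qq)), one_le_mul_of_one_le_of_one_le hE h3, ?_⟩
    intro z
    obtain ⟨k, hk⟩ := exists_index l z
    set G := ∏' k : ℕ, (1 + -(z / lamPt θ (l + k))) with hG
    have hlim : Filter.Tendsto
        (fun m : ℕ => ‖∏ j ∈ Finset.range (k + 1 + m), (1 - z / lamPt θ (l + j))‖)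
        Filter.atTop (nhds ‖G‖) := by
      have h1 := ((hconv {z} isCompact_singleton).tendsto_at (Set.mem_singleton z)).norm
      have h2 := h1.comp (Filter.tendsto_add_atTop_nat (k + 1))
      refine h2.congr fun m => ?_
      simp only [Function.comp, add_comm m]
    have hlow := ge_of_tendsto' hlim fun m => (partial_bound l θ hk m).1
    have hup := le_of_tendsto' hlim fun m => (partial_bound l θ hk m).2
    obtain ⟨hd1, hd2⟩ := dist_bound l θ hk
    obtain ⟨hm1, hm2⟩ := main_term l hl hk
    have hW : 0 < 1 + ‖z‖ ^ (3 / 2 + (l : ℝ)) := by positivity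
    set W := 1 + ‖z‖ ^ (3 / 2 + (l : ℝ))
    set d := Metric.infDist z (LamSet θ l)
    set D := ‖z - lamPt θ (l + k)‖
    set E := Real.exp (-(phi1 z))
    set V := VV l ‖z‖ k
    have hd : 0 ≤ d := Metric.infDist_nonneg
    have hD : 0 ≤ D := norm_nonneg _
    have hEp : 0 < E := Real.exp_pos _
    constructor
    · have e1 : 1 / (Real.exp (2 * AA + 6) * (3 / (1 - qq))) ≤ Real.exp (-(2 * AA)) * Real.exp (-6) := by
        rw [← Real.exp_add, show -(2 * AA) + -6 = -(2 * AA + 6) by ring, Real.exp_neg, ← one_div]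
        apply one_div_le_one_div_of_le (Real.exp_pos _)
        exact le_mul_of_one_le_right (Real.exp_pos _).le h3
      calc _ ≤ Real.exp (-(2 * AA)) * Real.exp (-6) * (D / W) := by gcongr
        _ ≤ Real.exp (-(2 * AA)) * (V * E * W) * (D / W) := by gcongr
        _ = Real.exp (-(2 * AA)) * (V * D) * E := by field_simp
        _ ≤ _ := by gcongr
    · calc ‖G‖ * E ≤ Real.exp (2 * AA) * (V * D) * E := by gcongr
        _ = Real.exp (2 * AA) * (V * E * W) * (D / W) := by field_simp
        _ ≤ Real.exp (2 * AA) * Real.exp 6 * ((3 / (1 - qq) * d) / W) := by gcongr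
        _ = _ := by rw [Real.exp_add]; ring

end
end

section
/- Let ν be a real number, let 0 < p < ∞, and let Λ ⊂ ℂ be a nonempty set which is a finite union of d_ρ-separated sets. Then the integral ∫_ℂ ( dist(z, Λ)/(1 + |z|^{3/2+ν}) )^p dm(z) is finite if and only if ν > 2/p − 1/2. -/
open MeasureTheory Complex
open scoped ENNReal

noncomputable section

/-- `ρ(z) = |z|/√2`. -/
def rho1 (z : ℂ) : ℝ := ‖z‖ / Real.sqrt 2

/-- `d_ρ(z,w) = |z-w|/(1 + min(ρ(z), ρ(w)))`. -/
def dRho1 (z w : ℂ) : ℝ := ‖z - w‖ / (1 + min (rho1 z) (rho1 w))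

/-- `Λ` is `d_ρ`-separated. -/
def DRhoSeparated1 (Λ : Set ℂ) : Prop :=
  ∃ ε : ℝ, 0 < ε ∧ ∀ l ∈ Λ, ∀ l' ∈ Λ, l ≠ l' → ε ≤ dRho1 l l'

lemma st11_suff (ν p : ℝ) (hp : 0 < p) (Λ : Set ℂ) (hne : Λ.Nonempty)
    (h : 2 / p - 1 / 2 < ν) :
    (∫⁻ z : ℂ, ENNReal.ofReal
        ((Metric.infDist z Λ / (1 + ‖z‖ ^ (3 / 2 + ν))) ^ p)) < ⊤ := by
  obtain ⟨l, hl⟩ := hne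
  set a := 3 / 2 + ν with ha
  have h2p : 0 < 2 / p := by positivity
  have ha0 : 0 < a := by linarith
  have hr : (2 : ℝ) < (a - 1) * p := by
    have : 2 / p < a - 1 := by linarith
    rwa [div_lt_iff₀ hp] at this
  set C : ℝ := (1 + ‖l‖) * 2 ^ a with hC
  have hC0 : 0 ≤ C := by positivity
  have key : ∀ z : ℂ, (Metric.infDist z Λ / (1 + ‖z‖ ^ a)) ^ p ≤
      C ^ p * (1 + ‖z‖) ^ (-((a - 1) * p)) := by
    intro z
    have hz := norm_nonneg z
    have hln := norm_nonneg l
    have hb : (0:ℝ) < 1 + ‖z‖ := by positivity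
    have h1 : Metric.infDist z Λ ≤ (1 + ‖l‖) * (1 + ‖z‖) := by
      have h2 := Metric.infDist_le_dist_of_mem (x := z) hl
      rw [dist_eq_norm] at h2
      have h3 := norm_sub_le z l
      nlinarith
    have h2 : (1 + ‖z‖) ^ a ≤ 2 ^ a * (1 + ‖z‖ ^ a) := by
      have hza : 0 ≤ ‖z‖ ^ a := by positivity
      have h2a : (0:ℝ) < 2 ^ a := by positivity
      rcases le_total ‖z‖ 1 with h | h
      · calc (1 + ‖z‖) ^ a ≤ 2 ^ a := Real.rpow_le_rpow hb.le (by linarith) ha0.le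
          _ ≤ _ := by nlinarith
      · calc (1 + ‖z‖) ^ a ≤ (2 * ‖z‖) ^ a := Real.rpow_le_rpow hb.le (by linarith) ha0.le
          _ = 2 ^ a * ‖z‖ ^ a := Real.mul_rpow (by norm_num) hz
          _ ≤ _ := by nlinarith
    have h3 : Metric.infDist z Λ / (1 + ‖z‖ ^ a) ≤ C * (1 + ‖z‖) ^ (-(a - 1)) := by
      rw [div_le_iff₀ (by positivity)]
      have h4 : (1 + ‖z‖) = (1 + ‖z‖) ^ (-(a - 1)) * (1 + ‖z‖) ^ a := by
        rw [← Real.rpow_add hb]; simp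
      calc _ ≤ (1 + ‖l‖) * (1 + ‖z‖) := h1
        _ = (1 + ‖l‖) * ((1 + ‖z‖) ^ (-(a - 1)) * (1 + ‖z‖) ^ a) := by rw [← h4]
        _ ≤ (1 + ‖l‖) * ((1 + ‖z‖) ^ (-(a - 1)) * (2 ^ a * (1 + ‖z‖ ^ a))) := by gcongr
        _ = _ := by rw [hC]; ring
    calc _ ≤ (C * (1 + ‖z‖) ^ (-(a - 1))) ^ p :=
          Real.rpow_le_rpow (div_nonneg Metric.infDist_nonneg (by positivity)) h3 hp.le
      _ = _ := by
        rw [Real.mul_rpow hC0 (by positivity), ← Real.rpow_mul hb.le, neg_mul]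
  calc _ ≤ ∫⁻ z : ℂ, ENNReal.ofReal (C ^ p) * ENNReal.ofReal ((1 + ‖z‖) ^ (-((a - 1) * p))) := by
        apply lintegral_mono
        intro z
        beta_reduce
        rw [← ENNReal.ofReal_mul (by positivity)]
        exact ENNReal.ofReal_le_ofReal (key z)
    _ = ENNReal.ofReal (C ^ p) * ∫⁻ z : ℂ, ENNReal.ofReal ((1 + ‖z‖) ^ (-((a - 1) * p))) :=
        lintegral_const_mul' _ _ ENNReal.ofReal_ne_top
    _ < ⊤ := by
      apply ENNReal.mul_lt_top ENNReal.ofReal_lt_top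
      apply finite_integral_one_add_norm
      rw [Complex.finrank_real_complex]; exact_mod_cast hr

/-- At every scale `R` there is a ball of radius `η R` free of `Λ`. -/
lemma st11_hole (Λ : Set ℂ) (hΛ : ∃ (m : ℕ) (Λs : Fin m → Set ℂ),
      (∀ i, DRhoSeparated1 (Λs i)) ∧ Λ = ⋃ i, Λs i) :
    ∃ η : ℝ, 0 < η ∧ ∀ R : ℝ, 0 < R → ∃ c : ℝ, R ≤ c ∧ c + η * R ≤ 3 / 2 * R ∧ η ≤ 1 / 2 ∧
      ∀ l ∈ Λ, η * R ≤ ‖l - (c : ℂ)‖ := by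
  obtain ⟨m, Λs, hs, rfl⟩ := hΛ
  choose e he0 he using hs
  obtain ⟨ε, hε0, hε⟩ : ∃ ε : ℝ, 0 < ε ∧ ∀ i, ε ≤ e i := by
    rcases isEmpty_or_nonempty (Fin m) with h | h
    · exact ⟨1, one_pos, fun i => h.elim i⟩
    · obtain ⟨i, hi⟩ := Finite.exists_min e
      exact ⟨e i, he0 i, hi⟩
  have hM : (0:ℝ) < 3 * m + 2 := by positivity
  set η := min (ε / 4) (1 / 2) / (3 * m + 2) with hη
  have hη0 : 0 < η := by positivity
  have hηM : η * (3 * m + 2) = min (ε / 4) (1 / 2) := by rw [hη]; field_simp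
  have hη1 : η * (3 * m + 2) ≤ ε / 4 := hηM ▸ min_le_left _ _
  have hη2 : η * (3 * m + 2) ≤ 1 / 2 := hηM ▸ min_le_right _ _
  have hm0 : (0:ℝ) ≤ m := by positivity
  have hηm : 0 ≤ η * m := by positivity
  refine ⟨η, hη0, fun R hR => ?_⟩
  by_contra! hcon
  have hj : ∀ j : Fin (m + 1), ∃ i : Fin m, ∃ l ∈ Λs i,
      ‖l - ((R * (1 + 3 * j * η) : ℝ) : ℂ)‖ < η * R := by
    intro j
    have hjm : (j : ℝ) ≤ m := by exact_mod_cast Nat.lt_succ_iff.mp j.2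
    have hjη : (j:ℝ) * η ≤ m * η := by gcongr
    have hj0 : 0 ≤ (j:ℝ) * η := by positivity
    obtain ⟨l, hl, h⟩ := hcon (R * (1 + 3 * j * η)) (by nlinarith) (by nlinarith) (by nlinarith)
    obtain ⟨i, hi⟩ := Set.mem_iUnion.mp hl
    exact ⟨i, l, hi, h⟩
  choose i l hl hd using hj
  obtain ⟨j, k, hjk, hijk⟩ := Fintype.exists_ne_map_eq_of_card_lt i (by simp)
  wlog hlt : j < k generalizing j k
  · exact this k j hjk.symm hijk.symm (lt_of_le_of_ne (not_lt.mp hlt) hjk.symm)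
  have hkm : (k : ℝ) ≤ m := by exact_mod_cast Nat.lt_succ_iff.mp k.2
  have hj0 : (0:ℝ) ≤ j := by positivity
  have hjk1 : (j : ℝ) + 1 ≤ k := by exact_mod_cast hlt
  have hηR : 0 < η * R := by positivity
  have hcc : ‖((R * (1 + 3 * j * η) : ℝ) : ℂ) - ((R * (1 + 3 * k * η) : ℝ) : ℂ)‖
      = 3 * (k - j) * (η * R) := by
    rw [← Complex.ofReal_sub, Complex.norm_real, Real.norm_eq_abs, abs_sub_comm,
      abs_of_nonneg] <;> nlinarith
  have hne : l j ≠ l k := by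
    intro h
    have h1 := hd j
    have h2 := hd k
    rw [← h] at h2
    have h3 := norm_sub_le_norm_sub_add_norm_sub
      ((R * (1 + 3 * j * η) : ℝ) : ℂ) (l j) ((R * (1 + 3 * k * η) : ℝ) : ℂ)
    rw [hcc, norm_sub_rev _ (l j)] at h3
    nlinarith
  have hnorm : ∀ t, R / 2 ≤ ‖l t‖ := by
    intro t
    have h1 := hd t
    have h2 := norm_sub_norm_le ((R * (1 + 3 * t * η) : ℝ) : ℂ) (l t)
    have ht : 0 ≤ (t:ℝ) * η := by positivity
    rw [norm_sub_rev, Complex.norm_real, Real.norm_eq_abs, abs_of_nonneg (by positivity)] at h2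
    have : 0 ≤ R * (t * η) := by positivity
    nlinarith
  have hsep := (hε _).trans (he (i j) (l j) (hl j) (l k) (hijk ▸ hl k) hne)
  have hrho : ∀ t, R / 4 ≤ rho1 (l t) := by
    intro t
    have h2 : Real.sqrt 2 ≤ 2 := by
      rw [Real.sqrt_le_left (by norm_num)]; norm_num
    unfold rho1
    rw [le_div_iff₀ (by positivity)]
    nlinarith [hnorm t]
  have hmin := le_min (hrho j) (hrho k)
  unfold dRho1 at hsep
  rw [le_div_iff₀ (by linarith)] at hsep
  have hdist : ‖l j - l k‖ ≤ (η * R) + 3 * (k - j) * (η * R) + η * R := by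
    have h3 := norm_sub_le_norm_sub_add_norm_sub
      (l j) ((R * (1 + 3 * j * η) : ℝ) : ℂ) (l k)
    have h4 := norm_sub_le_norm_sub_add_norm_sub
      ((R * (1 + 3 * j * η) : ℝ) : ℂ) ((R * (1 + 3 * k * η) : ℝ) : ℂ) (l k)
    rw [hcc, norm_sub_rev ((R * (1 + 3 * k * η) : ℝ) : ℂ) (l k)] at h4
    linarith [hd j, hd k]
  have hfin : ‖l j - l k‖ ≤ ε / 4 * R := by
    have : 3 * ((k:ℝ) - j) * (η * R) ≤ 3 * m * (η * R) := by gcongr; linarith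
    nlinarith
  nlinarith

lemma st11_pt (ν p R η x d : ℝ) (hp : 0 < p) (hR : 2 ≤ R) (hη : 0 < η)
    (hν : ν ≤ 2 / p - 1 / 2) (hx1 : 1 ≤ x) (hx2 : x ≤ 2 * R) (hd : η * R / 2 ≤ d) :
    (η / 8) ^ p / (2 * R) ^ 2 ≤ (d / (1 + x ^ (3 / 2 + ν))) ^ p := by
  have hR0 : 0 < R := by linarith
  have hx0 : 0 < x := by linarith
  have h2p : 0 < 2 / p := by positivity
  have h1 : x ^ (3 / 2 + ν) ≤ (2 * R) ^ (1 + 2 / p) :=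
    (Real.rpow_le_rpow_of_exponent_le hx1 (by linarith)).trans
      (Real.rpow_le_rpow hx0.le hx2 (by linarith))
  have h2 : 1 ≤ (2 * R) ^ (1 + 2 / p) := Real.one_le_rpow (by linarith) (by linarith)
  have h3 : (η * R / 2) / (2 * (2 * R) ^ (1 + 2 / p)) ≤ d / (1 + x ^ (3 / 2 + ν)) := by
    have := Real.rpow_pos_of_pos hx0 (3 / 2 + ν)
    apply div_le_div₀ (le_trans (by positivity) hd) hd (by positivity)
    linarith
  refine le_trans (le_of_eq ?_) (Real.rpow_le_rpow (by positivity) h3 hp.le)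
  have h4 : (η * R / 2) / (2 * (2 * R) ^ (1 + 2 / p)) = (η / 8) / (2 * R) ^ (2 / p) := by
    rw [Real.rpow_add (by positivity), Real.rpow_one]
    field_simp
    norm_num
  rw [h4, Real.div_rpow (x := η / 8) (by positivity) (by positivity), ← Real.rpow_mul (by positivity),
    div_mul_cancel₀ _ hp.ne']
  norm_num

lemma st11_nec (ν p : ℝ) (hp : 0 < p) (Λ : Set ℂ) (hne : Λ.Nonempty)
    (hΛ : ∃ (m : ℕ) (Λs : Fin m → Set ℂ),
      (∀ i, DRhoSeparated1 (Λs i)) ∧ Λ = ⋃ i, Λs i) (hν : ν ≤ 2 / p - 1 / 2) :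
    (∫⁻ z : ℂ, ENNReal.ofReal
        ((Metric.infDist z Λ / (1 + ‖z‖ ^ (3 / 2 + ν))) ^ p)) = ⊤ := by
  obtain ⟨η, hη0, H⟩ := st11_hole Λ hΛ
  set R : ℕ → ℝ := fun n => 4 ^ (n + 1) with hRdef
  have hR4 : ∀ n, 4 ≤ R n := fun n => by
    have : (1:ℝ) ≤ 4 ^ n := one_le_pow₀ (by norm_num)
    simp only [hRdef, pow_succ]; linarith
  have hR0 : ∀ n, 0 < R n := fun n => by linarith [hR4 n]
  choose c hc1 hc2 hη1 hc3 using fun n => H (R n) (hR0 n)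
  set B : ℕ → Set ℂ := fun n => Metric.ball (c n : ℂ) (η * R n / 2) with hB
  have hBn : ∀ n, ∀ w ∈ B n, R n / 2 ≤ ‖w‖ ∧ ‖w‖ < 2 * R n := by
    intro n w hw
    have hw' : ‖w - (c n : ℂ)‖ < η * R n / 2 := by simpa [hB, dist_eq_norm] using hw
    have hcn : ‖(c n : ℂ)‖ = c n := by
      rw [Complex.norm_real, Real.norm_eq_abs, abs_of_nonneg ((hR0 n).le.trans (hc1 n))]
    have h1 := norm_sub_norm_le w (c n : ℂ)
    have h2 := norm_sub_norm_le (c n : ℂ) w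
    rw [norm_sub_rev] at h2
    rw [hcn] at h1 h2
    have := hR0 n
    have h5 := hc1 n
    have h6 := hc2 n
    have h7 := hη1 n
    have h8 : 0 < η * R n := by positivity
    constructor <;> nlinarith
  have hdisj : Pairwise (Function.onFun Disjoint B) := by
    have hlt : ∀ n k, n < k → Disjoint (B n) (B k) := by
      intro n k hnk
      rw [Set.disjoint_left]
      intro w hw hw'
      have h1 := (hBn n w hw).2
      have h2 := (hBn k w hw').1
      have h3 : (4:ℝ) ^ (n + 1 + 1) ≤ 4 ^ (k + 1) :=
        pow_le_pow_right₀ (by norm_num) (by omega)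
      rw [pow_succ] at h3
      simp only [hRdef] at h1 h2
      linarith
    intro n k hnk
    rcases lt_or_gt_of_ne hnk with h | h
    · exact hlt n k h
    · exact (hlt k n h).symm
  set K : ℝ := (η / 8) ^ p * (η ^ 2 / 16) with hK
  have hK0 : 0 < K := by positivity
  have hlow : ∀ n, ENNReal.ofReal K ≤ ∫⁻ z in B n, ENNReal.ofReal
        ((Metric.infDist z Λ / (1 + ‖z‖ ^ (3 / 2 + ν))) ^ p) := by
    intro n
    have hRn := hR0 n
    calc ENNReal.ofReal K
        ≤ ENNReal.ofReal ((η / 8) ^ p / (2 * R n) ^ 2) * volume (B n) := by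
          rw [hB]
          simp only [Complex.volume_ball]
          have h1 : (1 : ℝ≥0∞) ≤ (NNReal.pi : ℝ≥0∞) := by
            have : (1 : NNReal) ≤ NNReal.pi := by
              rw [← NNReal.coe_le_coe]; simpa using by linarith [Real.pi_gt_three]
            exact_mod_cast this
          rw [← ENNReal.ofReal_pow (by positivity), ← mul_assoc,
            ← ENNReal.ofReal_mul (by positivity)]
          have h2 : (η / 8) ^ p / (2 * R n) ^ 2 * (η * R n / 2) ^ 2 = K := by
            rw [hK]; field_simp; norm_num
          rw [h2]
          exact le_mul_of_one_le_right zero_le h1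
      _ = ∫⁻ z in B n, ENNReal.ofReal ((η / 8) ^ p / (2 * R n) ^ 2) := by
          rw [setLIntegral_const]
      _ ≤ _ := by
          apply setLIntegral_mono' Metric.isOpen_ball.measurableSet
          intro z hz
          have hz1 := hBn n z hz
          apply ENNReal.ofReal_le_ofReal
          apply st11_pt ν p (R n) η _ _ hp (by linarith [hR4 n]) hη0 hν
            (by linarith [hR4 n]) hz1.2.le
          rw [Metric.le_infDist hne]
          intro l hl
          have hz' : ‖z - (c n : ℂ)‖ < η * R n / 2 := by simpa [hB, dist_eq_norm] using hz
          have h3 := hc3 n l hl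
          have h4 := norm_sub_le_norm_sub_add_norm_sub l z (c n : ℂ)
          rw [dist_eq_norm, norm_sub_rev]
          linarith
  rw [eq_top_iff]
  calc (⊤ : ℝ≥0∞) = ∑' _ : ℕ, ENNReal.ofReal K := by
        rw [ENNReal.tsum_const_eq_top_of_ne_zero]
        simpa using hK0
    _ ≤ ∑' n, ∫⁻ z in B n, ENNReal.ofReal
        ((Metric.infDist z Λ / (1 + ‖z‖ ^ (3 / 2 + ν))) ^ p) := ENNReal.tsum_le_tsum hlow
    _ = ∫⁻ z in ⋃ n, B n, ENNReal.ofReal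
        ((Metric.infDist z Λ / (1 + ‖z‖ ^ (3 / 2 + ν))) ^ p) :=
        (lintegral_iUnion (fun n => Metric.isOpen_ball.measurableSet) hdisj _).symm
    _ ≤ _ := setLIntegral_le_lintegral _ _

theorem statement11 (ν p : ℝ) (hp : 0 < p) (Λ : Set ℂ) (hne : Λ.Nonempty)
    (hΛ : ∃ (m : ℕ) (Λs : Fin m → Set ℂ),
      (∀ i, DRhoSeparated1 (Λs i)) ∧ Λ = ⋃ i, Λs i) :
    (∫⁻ z : ℂ, ENNReal.ofReal
        ((Metric.infDist z Λ / (1 + ‖z‖ ^ (3 / 2 + ν))) ^ p)) < ⊤ ↔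
      2 / p - 1 / 2 < ν := by
  constructor
  · intro h
    by_contra hν
    exact h.ne (st11_nec ν p hp Λ hne hΛ (not_lt.mp hν))
  · exact st11_suff ν p hp Λ hne

end
end

section
/- Let 1 ≤ p < ∞ and let Λ_{−1} = {e^{(1+n)/2} e^{iθ_n} : n ≥ −1} for arbitrary real numbers (θ_n)_{n≥−1}. Then Λ_{−1} is a uniqueness set of zero excess for F^p_φ if and only if p > 4. -/
open MeasureTheory Complex
open scoped ENNReal

noncomputable section

/-- `Λ` is a uniqueness set for `F^p_φ`. -/
def UniquenessSet (p : ℝ) (Λ : Set ℂ) : Prop :=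
  ∀ f : ℂ → ℂ, MemFock 1 p f → (∀ z ∈ Λ, f z = 0) → f = 0

/-- `Λ` is a zero set for `F^p_φ`: some nonzero `f ∈ F^p_φ` vanishes exactly on `Λ`,
with simple zeros. -/
def ZeroSet (p : ℝ) (Λ : Set ℂ) : Prop :=
  ∃ f : ℂ → ℂ, MemFock 1 p f ∧ f ≠ 0 ∧ (∀ z : ℂ, f z = 0 ↔ z ∈ Λ) ∧
    ∀ z ∈ Λ, deriv f z ≠ 0

/-- `Λ` is a uniqueness set of zero excess (exact uniqueness set) for `F^p_φ`. -/
def ExactUniquenessSet (p : ℝ) (Λ : Set ℂ) : Prop :=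
  UniquenessSet p Λ ∧ ∀ lam ∈ Λ, ZeroSet p (Λ \ {lam})

lemma tangent_rpow {p a x : ℝ} (hp : 1 ≤ p) (ha : 0 < a) (hx : 0 ≤ x) :
    a ^ p + p * a ^ (p - 1) * (x - a) ≤ x ^ p := by
  have h1 : -1 ≤ x / a - 1 := by
    have : 0 ≤ x / a := by positivity
    linarith
  have h2 := one_add_mul_self_le_rpow_one_add h1 hp
  have h3 : (1 + (x / a - 1)) = x / a := by ring
  rw [h3, Real.div_rpow hx ha.le] at h2
  have hap : 0 < a ^ p := Real.rpow_pos_of_pos ha p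
  rw [le_div_iff₀ hap] at h2
  have h4 : a ^ (p - 1) = a ^ p / a := by
    rw [Real.rpow_sub ha, Real.rpow_one]
  rw [h4]
  calc _ = (1 + p * (x / a - 1)) * a ^ p := by field_simp
    _ ≤ _ := h2

lemma circle_lower {p r : ℝ} (hp : 1 ≤ p) {h : ℂ → ℂ} (hh : Differentiable ℂ h) :
    ENNReal.ofReal (2 * Real.pi * ‖h 0‖ ^ p) ≤
      ∫⁻ t in Set.Ioo (-Real.pi) Real.pi, ENNReal.ofReal (‖h (circleMap 0 r t)‖ ^ p) := by
  have hpi := Real.pi_pos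
  rcases (norm_nonneg (h 0)).eq_or_lt with h0 | h0
  · rw [← h0, Real.zero_rpow (by linarith)]
    simp
  set a := ‖h 0‖ with ha
  have hc : Continuous (fun t => h (circleMap 0 r t)) := hh.continuous.comp (by fun_prop)
  have hcn : Continuous (fun t => ‖h (circleMap 0 r t)‖) := hc.norm
  have hcp : Continuous (fun t => ‖h (circleMap 0 r t)‖ ^ p) :=
    hcn.rpow_const (fun t => Or.inr (by linarith))
  have hav : Real.circleAverage h 0 r = h 0 := hh.diffContOnCl.circleAverage
  rw [Real.circleAverage_eq_integral_add (-Real.pi),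
    intervalIntegral.integral_comp_add_right (fun t => h (circleMap 0 r t))] at hav
  have e1 : 0 + -Real.pi = -Real.pi := by ring
  have e2 : 2 * Real.pi + -Real.pi = Real.pi := by ring
  rw [e1, e2] at hav
  have hle : 2 * Real.pi * a ≤ ∫ t in (-Real.pi)..Real.pi, ‖h (circleMap 0 r t)‖ := by
    have := intervalIntegral.norm_integral_le_integral_norm (μ := volume)
      (f := fun t => h (circleMap 0 r t)) (show -Real.pi ≤ Real.pi by linarith)
    refine le_trans ?_ this
    rw [ha, ← hav, norm_smul, Real.norm_of_nonneg (by positivity)]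
    field_simp
    exact le_rfl
  have hI : 2 * Real.pi * a ^ p ≤ ∫ t in (-Real.pi)..Real.pi, ‖h (circleMap 0 r t)‖ ^ p := by
    have hm : ∫ t in (-Real.pi)..Real.pi,
        (a ^ p + p * a ^ (p - 1) * (‖h (circleMap 0 r t)‖ - a)) ≤
        ∫ t in (-Real.pi)..Real.pi, ‖h (circleMap 0 r t)‖ ^ p := by
      apply intervalIntegral.integral_mono_on (by linarith)
      · exact (Continuous.intervalIntegrable (by fun_prop) _ _)
      · exact hcp.intervalIntegrable _ _
      · intro t _
        exact tangent_rpow hp h0 (norm_nonneg _)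
    refine le_trans ?_ hm
    rw [intervalIntegral.integral_add (by simp)
      (Continuous.intervalIntegrable (by fun_prop) _ _),
      intervalIntegral.integral_const_mul,
      intervalIntegral.integral_sub (hcn.intervalIntegrable _ _) (by simp)]
    simp only [intervalIntegral.integral_const, smul_eq_mul]
    have hpos : 0 ≤ p * a ^ (p - 1) := by
      have := Real.rpow_nonneg h0.le (p - 1)
      positivity
    have := mul_nonneg hpos (sub_nonneg.2 hle)
    nlinarith [this]
  rw [intervalIntegral.integral_of_le (by linarith), integral_Ioc_eq_integral_Ioo] at hI
  refine (ENNReal.ofReal_le_ofReal hI).trans (le_of_eq ?_)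
  apply ofReal_integral_eq_lintegral_ofReal
  · exact ((hcp.integrableOn_Icc).mono_set Set.Ioo_subset_Icc_self)
  · exact Filter.Eventually.of_forall (fun t => Real.rpow_nonneg (norm_nonneg _) _)

/-- Removing zeros with Blaschke factors. -/
lemma blaschke_remove {r : ℝ} (hr : 0 < r) (S : Finset ℂ) :
    ∀ f : ℂ → ℂ, Differentiable ℂ f → (∀ w ∈ S, w ≠ 0) → (∀ w ∈ S, f w = 0) →
      ∃ h : ℂ → ℂ, Differentiable ℂ h ∧ (∀ z, ‖z‖ = r → ‖h z‖ = ‖f z‖) ∧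
        ‖h 0‖ = ‖f 0‖ * ∏ w ∈ S, (r / ‖w‖) := by
  classical
  induction S using Finset.induction_on with
  | empty => intro f hf _ _; exact ⟨f, hf, fun _ _ => rfl, by simp⟩
  | insert a S ha ih =>
    intro f hf hS0 hS
    have ha0 : a ≠ 0 := hS0 a (by simp)
    have hfa : f a = 0 := hS a (by simp)
    have hd : Differentiable ℂ (dslope f a) := by
      rw [← differentiableOn_univ, differentiableOn_dslope Filter.univ_mem, differentiableOn_univ]
      exact hf
    have hdz : ∀ z, f z = (z - a) * dslope f a z := by
      intro z
      have := sub_smul_dslope f a z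
      rw [hfa, sub_zero, smul_eq_mul] at this
      exact this.symm
    obtain ⟨h, hh, hn, h0⟩ := ih
      (fun z => dslope f a z * (((r : ℂ) ^ 2 - (starRingEnd ℂ) a * z) / r)) (by fun_prop)
      (fun w hw => hS0 w (by simp [hw]))
      (fun w hw => by
        have h1 := hS w (by simp [hw])
        rw [hdz w] at h1
        have hwa : w - a ≠ 0 := by
          rw [sub_ne_zero]; rintro rfl; exact ha hw
        have := (mul_eq_zero.1 h1).resolve_left hwa
        simp [this])
    refine ⟨h, hh, ?_, ?_⟩
    · intro z hz
      rw [hn z hz, hdz z, norm_mul, norm_mul, mul_comm]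
      congr 1
      have hrr : (r : ℂ) ^ 2 = (starRingEnd ℂ) z * z := by
        rw [← Complex.normSq_eq_conj_mul_self, Complex.normSq_eq_norm_sq, hz]; push_cast; rfl
      rw [hrr, ← sub_mul, ← map_sub, norm_div, norm_mul, RCLike.norm_conj, hz, Complex.norm_real,
        Real.norm_of_nonneg hr.le]
      field_simp
    · rw [h0, Finset.prod_insert ha, hdz 0]
      have hna : ‖a‖ ≠ 0 := norm_ne_zero_iff.2 ha0
      simp only [norm_mul, mul_zero, sub_zero, zero_sub, norm_neg, norm_div, norm_pow,
        Complex.norm_real, Real.norm_of_nonneg hr.le]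
      field_simp

/-- Dividing out the zero at the origin. -/
lemma divide_origin {f : ℂ → ℂ} (hf : Differentiable ℂ f) (hne : f ≠ 0) :
    ∃ (m : ℕ) (g : ℂ → ℂ), Differentiable ℂ g ∧ g 0 ≠ 0 ∧ ∀ z, f z = z ^ m * g z := by
  have han : AnalyticAt ℂ f 0 := hf.analyticAt 0
  have hnz : ¬ ∀ᶠ z in nhds (0 : ℂ), f z = 0 := by
    intro h
    apply hne
    exact AnalyticOnNhd.eq_of_eventuallyEq (fun z _ => hf.analyticAt z)
      (fun z _ => analyticAt_const (v := (0 : ℂ))) (z₀ := 0) h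
  obtain ⟨m, g, hg, hg0, hfg⟩ := (han.exists_eventuallyEq_pow_smul_nonzero_iff).2 hnz
  refine ⟨m, fun z => if z = 0 then g 0 else f z / z ^ m, ?_, by simpa using hg0, ?_⟩
  · intro z
    by_cases hz : z = 0
    · subst hz
      apply hg.differentiableAt.congr_of_eventuallyEq
      filter_upwards [hfg] with w hw
      by_cases hw0 : w = 0
      · simp [hw0]
      · simp only [hw0, if_false]
        rw [hw]; simp [hw0]
    · have : DifferentiableAt ℂ (fun z => f z / z ^ m) z :=
        (hf z).div (by fun_prop) (pow_ne_zero _ hz)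
      apply this.congr_of_eventuallyEq
      filter_upwards [isOpen_ne.mem_nhds hz] with w hw
      simp [show w ≠ 0 from hw]
  · intro z
    by_cases hz : z = 0
    · subst hz
      have := hfg.self_of_nhds
      simpa using this
    · simp [hz]
      field_simp

lemma fock_top {p σ : ℝ} (hp : 1 ≤ p) (hσ : -1 ≤ p * σ + 1) {f : ℂ → ℂ}
    (hf : Differentiable ℂ f) (hne : f ≠ 0)
    (hS : ∀ s : ℝ, 0 < s → ∃ S : Finset ℂ, (∀ w ∈ S, w ≠ 0) ∧ (∀ w ∈ S, f w = 0) ∧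
      Real.exp (s ^ 2 + σ * s) ≤ ∏ w ∈ S, (Real.exp s / ‖w‖)) :
    fockNormP 1 p f = ⊤ := by
  obtain ⟨m, g, hg, hg0, hfg⟩ := divide_origin hf hne
  have hpi := Real.pi_pos
  set c : ℝ := 2 * Real.pi * ‖g 0‖ ^ p with hc
  have hcpos : 0 < c := by
    have := Real.rpow_pos_of_pos (norm_pos_iff.2 hg0) p
    positivity
  have hlow : ∀ r ∈ Set.Ioi (1 : ℝ), ENNReal.ofReal (c * r⁻¹) ≤
      ∫⁻ t in Set.Ioo (-Real.pi) Real.pi, ENNReal.ofReal r •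
        ENNReal.ofReal ((‖f (Complex.polarCoord.symm (r, t))‖ *
          Real.exp (-(phi 1 (Complex.polarCoord.symm (r, t))))) ^ p) := by
    intro r hr
    have hr1 : 1 < r := hr
    have hr0 : 0 < r := by linarith
    set s := Real.log r with hs
    have hs0 : 0 < s := Real.log_pos hr1
    have hers : Real.exp s = r := Real.exp_log hr0
    obtain ⟨S, hS0, hSf, hSp⟩ := hS s hs0
    rw [hers] at hSp
    obtain ⟨h, hh, hhn, hh0⟩ := blaschke_remove hr0 S g hg hS0 (by
      intro w hw
      have h1 := hSf w hw
      rw [hfg w] at h1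
      exact (mul_eq_zero.1 h1).resolve_left (pow_ne_zero _ (hS0 w hw)))
    have hcl := circle_lower (r := r) hp hh
    set K : ℝ := r * Real.exp (-(s ^ 2)) ^ p with hK
    have hKpos : 0 ≤ K := by positivity
    have step1 : c * r⁻¹ ≤ K * (2 * Real.pi * ‖h 0‖ ^ p) := by
      have h1 : ‖g 0‖ * Real.exp (s ^ 2 + σ * s) ≤ ‖h 0‖ := by
        rw [hh0]; gcongr
      have h2 : (‖g 0‖ * Real.exp (s ^ 2 + σ * s)) ^ p ≤ ‖h 0‖ ^ p :=
        Real.rpow_le_rpow (by positivity) h1 (by linarith)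
      rw [Real.mul_rpow (norm_nonneg _) (Real.exp_pos _).le] at h2
      have h3 : r⁻¹ ≤ K * Real.exp (s ^ 2 + σ * s) ^ p := by
        rw [hK, ← Real.exp_mul, ← Real.exp_mul, ← hers, ← Real.exp_neg, ← Real.exp_add,
          ← Real.exp_add, Real.exp_le_exp]
        nlinarith [mul_le_mul_of_nonneg_right hσ hs0.le]
      calc c * r⁻¹ ≤ c * (K * Real.exp (s ^ 2 + σ * s) ^ p) := by gcongr
        _ = K * (2 * Real.pi * (‖g 0‖ ^ p * Real.exp (s ^ 2 + σ * s) ^ p)) := by rw [hc]; ring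
        _ ≤ _ := by gcongr
    refine (ENNReal.ofReal_le_ofReal step1).trans ?_
    rw [ENNReal.ofReal_mul hKpos]
    refine (mul_le_mul_right hcl _).trans ?_
    rw [← lintegral_const_mul' _ _ ENNReal.ofReal_ne_top]
    apply lintegral_mono
    intro t
    have hz : Complex.polarCoord.symm (r, t) = circleMap 0 r t := by
      rw [Complex.polarCoord_symm_apply, circleMap, zero_add, Complex.exp_mul_I]
      push_cast; rfl
    have hzn : ‖circleMap 0 r t‖ = r := by simp [abs_of_pos hr0]
    have hph : phi 1 (circleMap 0 r t) = s ^ 2 := by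
      rw [phi, logPlus, hzn, max_eq_left hs0.le]; ring
    simp only [smul_eq_mul]
    rw [hz, hph, ← ENNReal.ofReal_mul hKpos, ← ENNReal.ofReal_mul hr0.le]
    apply ENNReal.ofReal_le_ofReal
    rw [Real.mul_rpow (norm_nonneg _) (Real.exp_pos _).le, hhn _ hzn, hK]
    have hle : ‖g (circleMap 0 r t)‖ ≤ ‖f (circleMap 0 r t)‖ := by
      rw [hfg, norm_mul, norm_pow, hzn]
      exact le_mul_of_one_le_left (norm_nonneg _) (one_le_pow₀ hr1.le)
    have hle2 := Real.rpow_le_rpow (norm_nonneg _) hle (by linarith : 0 ≤ p)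
    calc _ ≤ r * Real.exp (-(s ^ 2)) ^ p * ‖f (circleMap 0 r t)‖ ^ p := by gcongr
      _ = _ := by ring
  have hinf : ∫⁻ r in Set.Ioi (1 : ℝ), ENNReal.ofReal (c * r⁻¹) = ⊤ := by
    by_contra hne
    apply not_integrableOn_Ioi_inv (a := (1 : ℝ))
    have hI : IntegrableOn (fun r : ℝ => c * r⁻¹) (Set.Ioi 1) := by
      refine ⟨by fun_prop, ?_⟩
      rw [hasFiniteIntegral_iff_ofReal]
      · exact lt_top_iff_ne_top.2 hne
      · filter_upwards [ae_restrict_mem measurableSet_Ioi] with r hr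
        have : (0 : ℝ) < r := lt_trans one_pos hr
        simp only [Pi.zero_apply]; positivity
    have := hI.const_mul c⁻¹
    refine this.congr (Filter.Eventually.of_forall fun r => ?_)
    simp only; field_simp
  have hmeas : Measurable (fun z : ℂ => ENNReal.ofReal ((‖f z‖ * Real.exp (-(phi 1 z))) ^ p)) := by
    have := hf.continuous.measurable
    unfold phi logPlus
    fun_prop
  rw [fockNormP, ← Complex.lintegral_comp_polarCoord_symm, _root_.polarCoord_target,
    Measure.volume_eq_prod, setLIntegral_prod]
  · rw [eq_top_iff, ← hinf]
    refine (setLIntegral_mono' measurableSet_Ioi hlow).trans ?_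
    exact lintegral_mono_set (Set.Ioi_subset_Ioi zero_le_one)
  · apply Measurable.aemeasurable
    have hq : Measurable (fun q : ℝ × ℝ => Complex.polarCoord.symm q) := by
      have : (fun q : ℝ × ℝ => Complex.polarCoord.symm q) =
        fun q => (q.1 : ℂ) * ((Real.cos q.2 : ℂ) + (Real.sin q.2 : ℂ) * Complex.I) := by
        ext q; exact Complex.polarCoord_symm_apply q
      rw [this]
      fun_prop
    have h1 : Measurable (fun q : ℝ × ℝ => ENNReal.ofReal q.1) := by fun_prop
    exact h1.mul (hmeas.comp hq)

/-- Reindexing of the points by natural numbers. -/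
def LL (θ : ℤ → ℝ) (k : ℕ) : ℂ := lamPt θ ((k : ℤ) - 1)

lemma norm_LL (θ : ℤ → ℝ) (k : ℕ) : ‖LL θ k‖ = Real.exp ((k : ℝ) / 2) := by
  rw [LL, lamPt, norm_mul, Complex.norm_exp_ofReal_mul_I, Complex.norm_real, mul_one,
    Real.norm_of_nonneg (Real.exp_pos _).le]
  push_cast
  congr 1
  ring

lemma LL_ne_zero (θ : ℤ → ℝ) (k : ℕ) : LL θ k ≠ 0 := by
  rw [← norm_pos_iff, norm_LL]; exact Real.exp_pos _

lemma LL_inj (θ : ℤ → ℝ) : Function.Injective (LL θ) := by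
  intro a b h
  have h1 : ‖LL θ a‖ = ‖LL θ b‖ := by rw [h]
  rw [norm_LL, norm_LL, Real.exp_eq_exp] at h1
  have : (a : ℝ) = b := by linarith
  exact_mod_cast this

lemma mem_LamSet (θ : ℤ → ℝ) (w : ℂ) : w ∈ LamSet θ (-1) ↔ ∃ k, w = LL θ k := by
  constructor
  · rintro ⟨n, hn, rfl⟩
    refine ⟨(n + 1).toNat, ?_⟩
    rw [LL, Int.toNat_of_nonneg (by omega)]
    congr 1; ring
  · rintro ⟨k, rfl⟩
    exact ⟨(k : ℤ) - 1, by omega, rfl⟩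

lemma prod_full (s : ℝ) (N : ℕ) :
    ∏ k ∈ Finset.range N, (Real.exp s / Real.exp ((k : ℝ) / 2)) =
      Real.exp (N * s - N * (N - 1) / 4) := by
  induction N with
  | zero => simp
  | succ n ih =>
    rw [Finset.prod_range_succ, ih, ← Real.exp_sub, ← Real.exp_add]
    push_cast
    congr 1
    ring

lemma exists_full (s : ℝ) (hs : 0 < s) : ∃ N : ℕ, 1 ≤ N ∧
    Real.exp (s ^ 2 + 1 / 2 * s) ≤
      ∏ k ∈ Finset.range N, (Real.exp s / Real.exp ((k : ℝ) / 2)) := by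
  refine ⟨⌈2 * s⌉₊, Nat.one_le_ceil_iff.2 (by positivity), ?_⟩
  rw [prod_full, Real.exp_le_exp]
  have h1 := Nat.le_ceil (2 * s)
  have h2 := (Nat.ceil_lt_add_one (by positivity : 0 ≤ 2 * s)).le
  nlinarith [mul_nonneg (sub_nonneg.2 h1) (sub_nonneg.2 h2)]

lemma uniq (p : ℝ) (hp : 1 ≤ p) (θ : ℤ → ℝ) : UniquenessSet p (LamSet θ (-1)) := by
  intro f hf hz
  by_contra hne
  have := fock_top (σ := 1 / 2) hp (by linarith) hf.1 hne (by
    intro s hs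
    obtain ⟨N, _, hN⟩ := exists_full s hs
    refine ⟨(Finset.range N).map ⟨LL θ, LL_inj θ⟩, ?_, ?_, ?_⟩
    · intro w hw
      obtain ⟨k, _, rfl⟩ := Finset.mem_map.1 hw
      exact LL_ne_zero θ k
    · intro w hw
      obtain ⟨k, _, rfl⟩ := Finset.mem_map.1 hw
      exact hz _ ((mem_LamSet θ _).2 ⟨k, rfl⟩)
    · rw [Finset.prod_map]
      simp only [Function.Embedding.coeFn_mk, norm_LL]
      exact hN)
  exact absurd hf.2 (by simp [this])

lemma not_zero (p : ℝ) (hp : 1 ≤ p) (hp4 : p ≤ 4) (θ : ℤ → ℝ) :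
    ¬ ZeroSet p (LamSet θ (-1) \ {LL θ 0}) := by
  rintro ⟨f, hf, hne, hz, -⟩
  have := fock_top (σ := -1 / 2) hp (by linarith) hf.1 hne (by
    intro s hs
    obtain ⟨N, hN1, hN⟩ := exists_full s hs
    obtain ⟨M, rfl⟩ : ∃ M, N = M + 1 := ⟨N - 1, by omega⟩
    have hinj : Function.Injective (fun k : ℕ => LL θ (k + 1)) :=
      (LL_inj θ).comp Nat.succ_injective
    refine ⟨(Finset.range M).map ⟨fun k => LL θ (k + 1), hinj⟩, ?_, ?_, ?_⟩
    · intro w hw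
      obtain ⟨k, _, rfl⟩ := Finset.mem_map.1 hw
      exact LL_ne_zero θ _
    · intro w hw
      obtain ⟨k, _, rfl⟩ := Finset.mem_map.1 hw
      refine (hz _).2 ⟨(mem_LamSet θ _).2 ⟨k + 1, rfl⟩, ?_⟩
      intro h
      exact Nat.succ_ne_zero k (LL_inj θ (Set.mem_singleton_iff.1 h))
    · rw [Finset.prod_map]
      simp only [Function.Embedding.coeFn_mk, norm_LL]
      rw [Finset.prod_range_succ'] at hN
      simp only [Nat.cast_zero, zero_div, Real.exp_zero, div_one] at hN
      refine le_of_mul_le_mul_right (le_trans (le_of_eq ?_) hN) (Real.exp_pos s)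
      rw [← Real.exp_add]
      congr 1
      ring)
  exact absurd hf.2 (by simp [this])

lemma summable_half (s : ℝ) : Summable (fun k : ℕ => Real.exp (s - (k : ℝ) / 2)) := by
  have h : (fun k : ℕ => Real.exp (s - (k : ℝ) / 2)) =
      fun k : ℕ => Real.exp s * Real.exp (-(1 / 2)) ^ k := by
    ext k
    rw [← Real.exp_nat_mul, ← Real.exp_add]
    congr 1; ring
  rw [h]
  exact (summable_geometric_of_lt_one (Real.exp_pos _).le
    (by rw [Real.exp_lt_one_iff]; norm_num)).mul_left _

lemma exp_half_gt : (3 / 2 : ℝ) ≤ Real.exp (1 / 2) := by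
  have := Real.add_one_le_exp (1 / 2 : ℝ)
  linarith

lemma prod_upper : ∃ D : ℝ, 0 < D ∧ ∀ (M : ℕ) (s : ℝ), 0 ≤ s →
    ∏ k ∈ Finset.range M, (1 + Real.exp (s - (k : ℝ) / 2)) ≤
      D * Real.exp (s ^ 2 + s / 2 - 2 * Real.exp (-s)) := by
  set T := ∑' k : ℕ, Real.exp (1 / 2 - (k : ℝ) / 2) with hT
  refine ⟨Real.exp (T + 2), Real.exp_pos _, ?_⟩
  have base : ∀ (M : ℕ) (s : ℝ), 0 ≤ s → s ≤ 1 / 2 →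
      ∏ k ∈ Finset.range M, (1 + Real.exp (s - (k : ℝ) / 2)) ≤
      Real.exp (T + 2) * Real.exp (s ^ 2 + s / 2 - 2 * Real.exp (-s)) := by
    intro M s hs hs2
    have h1 : ∏ k ∈ Finset.range M, (1 + Real.exp (s - (k : ℝ) / 2)) ≤
        ∏ k ∈ Finset.range M, Real.exp (Real.exp (1 / 2 - (k : ℝ) / 2)) := by
      apply Finset.prod_le_prod
      · intro k _; positivity
      · intro k _
        have h2 : Real.exp (s - (k : ℝ) / 2) ≤ Real.exp (1 / 2 - (k : ℝ) / 2) :=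
          Real.exp_le_exp.2 (by linarith)
        have := Real.add_one_le_exp (Real.exp (1 / 2 - (k : ℝ) / 2))
        linarith
    refine h1.trans ?_
    rw [← Real.exp_sum, ← Real.exp_add, Real.exp_le_exp]
    have h2 : ∑ k ∈ Finset.range M, Real.exp (1 / 2 - (k : ℝ) / 2) ≤ T :=
      (summable_half (1 / 2)).sum_le_tsum _ (fun _ _ => (Real.exp_pos _).le)
    have h3 : Real.exp (-s) ≤ 1 := Real.exp_le_one_iff.2 (by linarith)
    nlinarith
  intro M
  induction M with
  | zero =>
    intro s hs
    by_cases h : s ≤ 1 / 2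
    · exact base 0 s hs h
    · simp only [Finset.range_zero, Finset.prod_empty]
      rw [← Real.exp_add, Real.one_le_exp_iff]
      have h3 : Real.exp (-s) ≤ 1 := Real.exp_le_one_iff.2 (by linarith)
      have : 0 ≤ T := tsum_nonneg (fun _ => (Real.exp_pos _).le)
      nlinarith
  | succ M ih =>
    intro s hs
    by_cases h : s ≤ 1 / 2
    · exact base _ s hs h
    push Not at h
    rw [Finset.prod_range_succ']
    have hi := ih (s - 1 / 2) (by linarith)
    have e : ∀ k : ℕ, s - ((k + 1 : ℕ) : ℝ) / 2 = s - 1 / 2 - (k : ℝ) / 2 := by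
      intro k; push_cast; ring
    simp only [e, Nat.cast_zero, zero_div, sub_zero]
    have h1 : 1 + Real.exp s ≤ Real.exp (s + Real.exp (-s)) := by
      have := Real.add_one_le_exp (Real.exp (-s))
      rw [Real.exp_add]
      calc 1 + Real.exp s = Real.exp s * (Real.exp (-s) + 1) := by
            rw [mul_add, ← Real.exp_add]; simp
        _ ≤ _ := by gcongr
    calc _ ≤ (Real.exp (T + 2) * Real.exp ((s - 1 / 2) ^ 2 + (s - 1 / 2) / 2
            - 2 * Real.exp (-(s - 1 / 2)))) * Real.exp (s + Real.exp (-s)) := by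
          gcongr
      _ ≤ _ := by
        rw [mul_assoc, ← Real.exp_add]
        gcongr
        have h4 : Real.exp (-(s - 1 / 2)) = Real.exp (1 / 2) * Real.exp (-s) := by
          rw [← Real.exp_add]; congr 1; ring
        rw [h4]
        nlinarith [exp_half_gt, Real.exp_pos (-s)]

/-- The canonical product. -/
def GG (a : ℕ → ℂ) (z : ℂ) : ℂ := ∏' k, (1 + a k * z)

lemma GG_mult {a : ℕ → ℂ} (ha : Summable (fun k => ‖a k‖)) (z : ℂ) :
    Multipliable (fun k => 1 + a k * z) := by
  apply multipliable_one_add_of_summable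
  simp only [norm_mul]
  exact ha.mul_right _

lemma GG_diff {a : ℕ → ℂ} (ha : Summable (fun k => ‖a k‖)) : Differentiable ℂ (GG a) := by
  intro z
  have h := Summable.hasProdLocallyUniformlyOn_nat_one_add (f := fun k z => a k * z)
    (K := Metric.ball (0 : ℂ) (‖z‖ + 1)) Metric.isOpen_ball (ha.mul_right (‖z‖ + 1))
    (Filter.Eventually.of_forall (fun n x hx => by
      rw [norm_mul]
      have : ‖x‖ ≤ ‖z‖ + 1 := (mem_ball_zero_iff.1 hx).le
      gcongr))
    (fun n => by fun_prop)
  have h2 : DifferentiableOn ℂ (fun x => ∏' i, (1 + a i * x)) (Metric.ball (0 : ℂ) (‖z‖ + 1)) := by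
    apply TendstoLocallyUniformlyOn.differentiableOn h _ Metric.isOpen_ball
    exact Filter.Eventually.of_forall (fun t => by fun_prop)
  exact h2.differentiableAt (Metric.isOpen_ball.mem_nhds (by simp))

lemma GG_ne {a : ℕ → ℂ} (ha : Summable (fun k => ‖a k‖)) {z : ℂ} (h : ∀ k, 1 + a k * z ≠ 0) :
    GG a z ≠ 0 := by
  apply tprod_one_add_ne_zero_of_summable h
  simp only [norm_mul]
  exact ha.mul_right _

lemma summable_update {a : ℕ → ℂ} (ha : Summable (fun k => ‖a k‖)) (j : ℕ) :
    Summable (fun k => ‖if k = j then 0 else a k‖) := by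
  refine Summable.of_nonneg_of_le (fun k => norm_nonneg _) (fun k => ?_) ha
  split_ifs <;> simp

lemma GG_split {a : ℕ → ℂ} (ha : Summable (fun k => ‖a k‖)) (j : ℕ) (z : ℂ) :
    GG a z = (1 + a j * z) * GG (fun k => if k = j then 0 else a k) z := by
  have hm := GG_mult (summable_update ha j) z
  have he : Function.update (fun k => 1 + a k * z) j 1 =
      fun k => 1 + (if k = j then 0 else a k) * z := by
    ext k
    by_cases h : k = j
    · subst h; simp
    · simp [h]
  have := Multipliable.tprod_eq_mul_tprod_ite' (L := SummationFilter.unconditional ℕ)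
    (f := fun k => 1 + a k * z) j (by rw [he]; exact hm)
  rw [GG, this, GG]
  congr 1
  apply tprod_congr
  intro k
  by_cases h : k = j
  · simp [h]
  · simp [h]

lemma zero_set (p : ℝ) (hp4 : 4 < p) (θ : ℤ → ℝ) (j : ℕ) :
    ZeroSet p (LamSet θ (-1) \ {LL θ j}) := by
  set a : ℕ → ℂ := fun k => if k = j then 0 else -(LL θ k)⁻¹ with ha
  have hs0 : Summable (fun k => ‖-(LL θ k)⁻¹‖) := by
    refine (summable_half 0).congr (fun k => ?_)
    rw [norm_neg, norm_inv, norm_LL, ← Real.exp_neg]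
    congr 1; ring
  have hs : Summable (fun k => ‖a k‖) := summable_update hs0 j
  have hfac : ∀ k z, 1 + a k * z = 0 ↔ k ≠ j ∧ z = LL θ k := by
    intro k z
    by_cases h : k = j
    · simp [ha, h]
    · have := LL_ne_zero θ k
      simp only [ha, h, if_false, ne_eq, not_false_eq_true, true_and]
      constructor
      · intro h1
        field_simp at h1
        linear_combination -h1
      · rintro rfl
        field_simp
        ring
  have hdiff := GG_diff hs
  have hzero : ∀ z, GG a z = 0 ↔ z ∈ LamSet θ (-1) \ {LL θ j} := by
    intro z
    constructor
    · intro h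
      by_contra hz
      apply GG_ne hs _ h
      intro k hk
      obtain ⟨hkj, rfl⟩ := (hfac k z).1 hk
      apply hz
      exact ⟨(mem_LamSet θ _).2 ⟨k, rfl⟩, fun h => hkj (LL_inj θ h)⟩
    · rintro ⟨h1, h2⟩
      obtain ⟨k, rfl⟩ := (mem_LamSet θ z).1 h1
      have hkj : k ≠ j := by rintro rfl; exact h2 rfl
      rw [GG_split hs k, (hfac k _).2 ⟨hkj, rfl⟩, zero_mul]
  have hbound : ∃ C : ℝ, 0 ≤ C ∧ ∀ z, ‖GG a z‖ * Real.exp (-(phi 1 z)) ≤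
      C * (1 + ‖z‖) ^ (-(1 / 2) : ℝ) := by
    obtain ⟨D, hD, hDb⟩ := prod_upper
    obtain ⟨B, hB⟩ := (isCompact_closedBall (0 : ℂ) 1).exists_bound_of_continuousOn
      hdiff.continuous.continuousOn
    have hB0 : 0 ≤ B := (norm_nonneg _).trans (hB 0 (by simp))
    refine ⟨2 * B + 2 * (D * Real.exp ((j : ℝ) / 2)), by positivity, ?_⟩
    intro z
    have hpos : 0 < (1 + ‖z‖) ^ (-(1 / 2) : ℝ) := Real.rpow_pos_of_pos (by positivity) _
    have h2 : (1 / 2 : ℝ) ≤ 2 ^ (-(1 / 2) : ℝ) := by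
      rw [show (1 / 2 : ℝ) = 2 ^ (-1 : ℝ) by rw [Real.rpow_neg_one]; norm_num]
      exact Real.rpow_le_rpow_of_exponent_le (by norm_num) (by norm_num)
    rcases le_total ‖z‖ 1 with hz | hz
    · have h1 := hB z (by simpa using hz)
      have h3 : Real.exp (-(phi 1 z)) ≤ 1 := by
        rw [Real.exp_le_one_iff, phi]
        nlinarith [sq_nonneg (logPlus ‖z‖)]
      have h4 : (2 : ℝ) ^ (-(1 / 2) : ℝ) ≤ (1 + ‖z‖) ^ (-(1 / 2) : ℝ) :=
        Real.rpow_le_rpow_of_nonpos (by positivity) (by linarith) (by norm_num)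
      have h5 : 0 ≤ D * Real.exp ((j : ℝ) / 2) := by positivity
      calc _ ≤ B * 1 := by gcongr
        _ = (2 * B) * (1 / 2) := by ring
        _ ≤ (2 * B) * (1 + ‖z‖) ^ (-(1 / 2) : ℝ) := by gcongr; linarith
        _ ≤ _ := by gcongr; linarith
    · set s := Real.log ‖z‖ with hsdef
      have hz0 : 0 < ‖z‖ := by linarith
      have hes : Real.exp s = ‖z‖ := Real.exp_log hz0
      have hsn : 0 ≤ s := Real.log_nonneg hz
      have hphi : phi 1 z = s ^ 2 := by
        rw [phi, logPlus, max_eq_left hsn]; ring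
      have hG : ‖GG a z‖ ≤ D * Real.exp ((j : ℝ) / 2) * Real.exp (s ^ 2 - s / 2) := by
        have ht := (GG_mult hs z).hasProd.tendsto_prod_nat.norm
        apply le_of_tendsto ht
        filter_upwards [Filter.eventually_gt_atTop j] with M hM
        have hjm : j ∈ Finset.range M := Finset.mem_range.2 hM
        have hu := hDb M s hsn
        rw [← Finset.mul_prod_erase _ _ hjm] at hu
        have h6 : ‖∏ k ∈ Finset.range M, (1 + a k * z)‖ ≤
            ∏ k ∈ (Finset.range M).erase j, (1 + Real.exp (s - (k : ℝ) / 2)) := by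
          rw [← Finset.mul_prod_erase _ _ hjm, norm_mul, norm_prod]
          have : ‖1 + a j * z‖ = 1 := by simp [ha]
          rw [this, one_mul]
          apply Finset.prod_le_prod (fun _ _ => norm_nonneg _)
          intro k hk
          have hkj := Finset.ne_of_mem_erase hk
          refine (norm_add_le _ _).trans ?_
          rw [norm_one, norm_mul]
          simp only [ha, hkj, if_false]
          rw [norm_neg, norm_inv, norm_LL, Real.exp_sub, hes, ← div_eq_inv_mul]
        refine h6.trans ?_
        set Q := ∏ k ∈ (Finset.range M).erase j, (1 + Real.exp (s - (k : ℝ) / 2)) with hQ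
        have hQ0 : 0 ≤ Q := Finset.prod_nonneg (fun _ _ => by positivity)
        have h7 : Real.exp (s - (j : ℝ) / 2) * Q ≤ D * Real.exp (s ^ 2 + s / 2) := by
          calc _ ≤ (1 + Real.exp (s - (j : ℝ) / 2)) * Q := by gcongr; linarith
            _ ≤ _ := hu
            _ ≤ _ := by
              gcongr
              have := Real.exp_pos (-s)
              linarith
        refine le_of_mul_le_mul_left (h7.trans (le_of_eq ?_)) (Real.exp_pos (s - (j : ℝ) / 2))
        rw [show Real.exp (s - (j : ℝ) / 2) * (D * Real.exp ((j : ℝ) / 2) *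
          Real.exp (s ^ 2 - s / 2)) = D * (Real.exp (s - (j : ℝ) / 2) * Real.exp ((j : ℝ) / 2) *
          Real.exp (s ^ 2 - s / 2)) by ring, ← Real.exp_add, ← Real.exp_add]
        congr 2
        ring
      have h8 : Real.exp (-(s / 2)) ≤ 2 * (1 + ‖z‖) ^ (-(1 / 2) : ℝ) := by
        have e1 : Real.exp (-(s / 2)) = ‖z‖ ^ (-(1 / 2) : ℝ) := by
          rw [← hes, ← Real.exp_mul]; congr 1; ring
        have e2 : (2 * ‖z‖) ^ (-(1 / 2) : ℝ) ≤ (1 + ‖z‖) ^ (-(1 / 2) : ℝ) :=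
          Real.rpow_le_rpow_of_nonpos (by positivity) (by linarith) (by norm_num)
        rw [Real.mul_rpow (by norm_num) hz0.le] at e2
        rw [e1]
        have e3 : 0 ≤ ‖z‖ ^ (-(1 / 2) : ℝ) := by positivity
        nlinarith
      rw [hphi]
      calc _ ≤ (D * Real.exp ((j : ℝ) / 2) * Real.exp (s ^ 2 - s / 2)) * Real.exp (-s ^ 2) := by
            gcongr
        _ = D * Real.exp ((j : ℝ) / 2) * Real.exp (-(s / 2)) := by
            rw [mul_assoc, ← Real.exp_add]; congr 2; ring
        _ ≤ D * Real.exp ((j : ℝ) / 2) * (2 * (1 + ‖z‖) ^ (-(1 / 2) : ℝ)) := by gcongr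
        _ = (2 * (D * Real.exp ((j : ℝ) / 2))) * (1 + ‖z‖) ^ (-(1 / 2) : ℝ) := by ring
        _ ≤ _ := by gcongr; linarith
  refine ⟨GG a, ⟨hdiff, ?_⟩, ?_, hzero, ?_⟩
  · obtain ⟨C, hC, hb⟩ := hbound
    have hfin := finite_integral_one_add_norm (E := ℂ) (μ := volume) (r := p / 2) (by
      rw [Complex.finrank_real_complex]; push_cast; linarith)
    rw [fockNormP]
    calc _ ≤ ∫⁻ z : ℂ, ENNReal.ofReal (C ^ p) * ENNReal.ofReal ((1 + ‖z‖) ^ (-(p / 2))) := by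
          apply lintegral_mono
          intro z
          simp only
          rw [← ENNReal.ofReal_mul (by positivity)]
          apply ENNReal.ofReal_le_ofReal
          refine (Real.rpow_le_rpow (by positivity) (hb z) (by linarith)).trans (le_of_eq ?_)
          rw [Real.mul_rpow hC (by positivity), ← Real.rpow_mul (by positivity)]
          congr 2; ring
      _ < ⊤ := by
          rw [lintegral_const_mul' _ _ ENNReal.ofReal_ne_top]
          exact ENNReal.mul_lt_top ENNReal.ofReal_lt_top hfin
  · intro h
    have h0 : GG a 0 = 0 := by rw [h]; rfl
    apply GG_ne hs _ h0
    intro k; simp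
  · rintro z ⟨h1, h2⟩
    obtain ⟨k, rfl⟩ := (mem_LamSet θ z).1 h1
    have hkj : k ≠ j := by rintro rfl; exact h2 rfl
    set b : ℕ → ℂ := fun i => if i = k then 0 else a i with hb
    have hsb : Summable (fun i => ‖b i‖) := summable_update hs k
    have hfun : GG a = fun z => (1 + a k * z) * GG b z := by
      ext z; exact GG_split hs k z
    have h0 : 1 + a k * LL θ k = 0 := (hfac k _).2 ⟨hkj, rfl⟩
    have hd1 : HasDerivAt (fun z => 1 + a k * z) (a k) (LL θ k) := by
      simpa using ((hasDerivAt_id (LL θ k)).const_mul (a k)).const_add 1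
    have hd := hd1.mul (GG_diff hsb (LL θ k)).hasDerivAt
    have hder : deriv (GG a) (LL θ k) = a k * GG b (LL θ k) := by
      rw [hfun]
      refine hd.deriv.trans ?_
      rw [h0]; ring
    rw [hder]
    apply mul_ne_zero
    · simp only [ha, hkj, if_false]
      exact neg_ne_zero.2 (inv_ne_zero (LL_ne_zero θ k))
    · apply GG_ne hsb
      intro i hi
      by_cases hik : i = k
      · simp [hb, hik] at hi
      · simp only [hb, hik, if_false] at hi
        exact hik (LL_inj θ ((hfac i _).1 hi).2.symm)

/-- `Λ_{-1}` is a uniqueness set of zero excess for `F^p_φ` iff `p > 4`. -/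
theorem statement12 (p : ℝ) (hp : 1 ≤ p) (θ : ℤ → ℝ) :
    ExactUniquenessSet p (LamSet θ (-1)) ↔ 4 < p := by
  constructor
  · intro h
    by_contra hp4
    push Not at hp4
    exact not_zero p hp hp4 θ (h.2 _ ((mem_LamSet θ _).2 ⟨0, rfl⟩))
  · intro hp4
    refine ⟨uniq p hp θ, ?_⟩
    intro lam hlam
    obtain ⟨k, rfl⟩ := (mem_LamSet θ lam).1 hlam
    exact zero_set p hp4 θ k

end
end

section
/- Let 1 ≤ p < 4/3 and let Λ_1 = {e^{(1+n)/2} e^{iθ_n} : n ≥ 1} for arbitrary real numbers (θ_n)_{n≥1}. Then Λ_1 is a uniqueness set of zero excess for F^p_φ. -/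
open MeasureTheory Complex
open scoped ENNReal

noncomputable section

lemma entire_factor {g : ℂ → ℂ} (hg : Differentiable ℂ g) {lam : ℕ → ℂ}
    (hl : Function.Injective lam) (h0 : ∀ n, g (lam n) = 0) (N : ℕ) :
    ∃ q : ℂ → ℂ, Differentiable ℂ q ∧ ∀ z, g z = q z * ∏ n ∈ Finset.range N, (z - lam n) := by
  induction N with
  | zero => exact ⟨g, hg, by simp⟩
  | succ N ih =>
    obtain ⟨q, hq, hgq⟩ := ih
    have hz : q (lam N) = 0 := by
      have h1 := hgq (lam N)
      rw [h0] at h1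
      rcases mul_eq_zero.1 h1.symm with h | h
      · exact h
      · rw [Finset.prod_eq_zero_iff] at h
        obtain ⟨a, ha, h⟩ := h
        have := hl (sub_eq_zero.1 h)
        simp at ha
        omega
    refine ⟨dslope q (lam N), ?_, fun z => ?_⟩
    · rw [← differentiableOn_univ, Complex.differentiableOn_dslope Filter.univ_mem]
      exact hq.differentiableOn
    · rw [hgq z, Finset.prod_range_succ]
      have := sub_smul_dslope q (lam N) z
      rw [hz, sub_zero, smul_eq_mul] at this
      rw [← this]; ring

lemma entire_pow_factor {f : ℂ → ℂ} (hf : Differentiable ℂ f) (hne : f ≠ 0) :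
    ∃ (k : ℕ) (g : ℂ → ℂ), Differentiable ℂ g ∧ g 0 ≠ 0 ∧ ∀ z, f z = z ^ k * g z := by
  obtain ⟨p, hp⟩ := hf.analyticAt 0
  have hp0 : p ≠ 0 := by
    intro h
    have h1 := hp.locally_zero_iff.2 h
    apply hne
    have ha : AnalyticOnNhd ℂ f Set.univ := fun z _ => hf.analyticAt z
    have hb : AnalyticOnNhd ℂ (0 : ℂ → ℂ) Set.univ := fun z _ => analyticAt_const
    exact ha.eq_of_eventuallyEq hb h1
  refine ⟨p.order, (Function.swap dslope 0)^[p.order] f, ?_, hp.iterate_dslope_fslope_ne_zero hp0,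
    fun z => by simpa using hp.eq_pow_order_mul_iterate_dslope z⟩
  generalize p.order = n
  induction n with
  | zero => exact hf
  | succ n ih =>
    rw [Function.iterate_succ_apply']
    change Differentiable ℂ (dslope _ 0)
    rw [← differentiableOn_univ, Complex.differentiableOn_dslope Filter.univ_mem]
    exact ih.differentiableOn

lemma norm_sub_circle {r : ℝ} (hr : 0 < r) (a z : ℂ) (hz : ‖z‖ = r) :
    ‖(r : ℂ) - (starRingEnd ℂ) a * z / r‖ = ‖z - a‖ := by
  have hr' : (r : ℂ) ≠ 0 := by exact_mod_cast hr.ne'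
  have : (r : ℂ) - (starRingEnd ℂ) a * z / r = (z / r) * (starRingEnd ℂ) (z - a) := by
    have h1 : z * (starRingEnd ℂ) z = (r : ℂ) ^ 2 := by
      rw [Complex.mul_conj', hz]
    rw [map_sub]
    field_simp
    rw [mul_sub, h1]
    ring
  rw [this, norm_mul, Complex.norm_conj, norm_div, hz, Complex.norm_real, Real.norm_of_nonneg hr.le,
    div_self hr.ne', one_mul]

lemma mean_lower {h : ℂ → ℂ} (hh : Differentiable ℂ h) (r : ℝ) :
    2 * Real.pi * ‖h 0‖ ≤ ∫ t in (-Real.pi)..Real.pi, ‖h (circleMap 0 r t)‖ := by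
  have h1 : Real.circleAverage h 0 r = h 0 :=
    DiffContOnCl.circleAverage hh.diffContOnCl
  have hper : Function.Periodic (fun t => ‖h (circleMap 0 r t)‖) (2 * Real.pi) := by
    intro t
    simp [periodic_circleMap 0 r t]
  have h2 := hper.intervalIntegral_add_eq (-Real.pi) 0
  rw [show -Real.pi + 2 * Real.pi = Real.pi by ring, zero_add] at h2
  rw [h2, ← h1, Real.circleAverage_def, norm_smul]
  have h3 : ‖∫ t in (0 : ℝ)..2 * Real.pi, h (circleMap 0 r t)‖ ≤
      ∫ t in (0 : ℝ)..2 * Real.pi, ‖h (circleMap 0 r t)‖ :=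
    intervalIntegral.norm_integral_le_integral_norm (by positivity)
  rw [Real.norm_of_nonneg (by positivity), ← mul_assoc, mul_inv_cancel₀ (by positivity), one_mul]
  exact h3

lemma mean_rpow_lower {u : ℝ → ℝ} (hu : Continuous u) (hu0 : ∀ t, 0 ≤ u t) {p M : ℝ} (hp : 1 ≤ p)
    (hM : 0 < M) (h : 2 * Real.pi * M ≤ ∫ t in (-Real.pi)..Real.pi, u t) :
    2 * Real.pi * M ^ p ≤ ∫ t in (-Real.pi)..Real.pi, (u t) ^ p := by
  have key : ∀ t, M ^ p + p * M ^ (p - 1) * (u t - M) ≤ (u t) ^ p := by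
    intro t
    have h1 := one_add_mul_self_le_rpow_one_add (s := u t / M - 1)
      (by have := div_nonneg (hu0 t) hM.le; linarith) hp
    rw [add_sub_cancel, Real.div_rpow (hu0 t) hM.le, le_div_iff₀ (by positivity)] at h1
    refine le_trans (le_of_eq ?_) h1
    rw [Real.rpow_sub_one hM.ne']
    field_simp
  have hc : Continuous (fun t => (u t) ^ p) := hu.rpow_const (fun t => Or.inr (by linarith))
  calc 2 * Real.pi * M ^ p ≤ ∫ t in (-Real.pi)..Real.pi, (M ^ p + p * M ^ (p - 1) * (u t - M)) := by
        rw [intervalIntegral.integral_add (by simp) (Continuous.intervalIntegrable (by fun_prop) _ _),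
          intervalIntegral.integral_const_mul,
          intervalIntegral.integral_sub (hu.intervalIntegrable _ _) (by simp)]
        simp only [intervalIntegral.integral_const, smul_eq_mul]
        have : 0 ≤ p * M ^ (p - 1) * ((∫ t in (-Real.pi)..Real.pi, u t) - 2 * Real.pi * M) := by
          apply mul_nonneg (by positivity); linarith
        have e : (Real.pi - -Real.pi) = 2 * Real.pi := by ring
        rw [e]
        linarith
    _ ≤ _ := by
        apply intervalIntegral.integral_mono_on (by linarith [Real.pi_pos])
        · exact Continuous.intervalIntegrable (by fun_prop) _ _
        · exact hc.intervalIntegrable _ _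
        · intro t _; exact key t

lemma sum_exponent (t : ℝ) (N : ℕ) :
    ∑ n ∈ Finset.range N, (t - 1 - (n : ℝ) / 2) = N * t - 3 * N / 4 - (N : ℝ) ^ 2 / 4 := by
  induction N with
  | zero => simp
  | succ N ih => rw [Finset.sum_range_succ, ih]; push_cast; ring

lemma circle_lower_s14 {g : ℂ → ℂ} (hg : Differentiable ℂ g) {lam : ℕ → ℂ}
    (hl : ∀ n, ‖lam n‖ = Real.exp (1 + (n : ℝ) / 2)) (h0 : ∀ n, g (lam n) = 0) (hg0 : g 0 ≠ 0)
    {p t : ℝ} (hp : 1 ≤ p) (ht : 1 ≤ t) :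
    2 * Real.pi * (‖g 0‖ * Real.exp (t ^ 2 - 3 / 2 * t)) ^ p ≤
      ∫ s in (-Real.pi)..Real.pi, ‖g (circleMap 0 (Real.exp t) s)‖ ^ p := by
  have hinj : Function.Injective lam := by
    intro a b hab
    have := congrArg norm hab
    rw [hl, hl, Real.exp_eq_exp] at this
    have h2 : (a : ℝ) = b := by linarith
    exact_mod_cast h2
  set r := Real.exp t with hr
  have hr0 : 0 < r := Real.exp_pos t
  obtain ⟨N, hN1, hN2⟩ : ∃ N : ℕ, (N : ℝ) ≤ 2 * t - 1 ∧ 2 * t - 1 < N + 1 :=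
    ⟨⌊2 * t - 1⌋₊, Nat.floor_le (by linarith), Nat.lt_floor_add_one _⟩
  obtain ⟨q, hq, hgq⟩ := entire_factor hg hinj h0 N
  set h : ℂ → ℂ := fun z => q z * ∏ n ∈ Finset.range N, ((r : ℂ) - (starRingEnd ℂ) (lam n) * z / r)
    with hh
  have hhd : Differentiable ℂ h := by
    apply hq.mul
    apply Differentiable.fun_finsetProd
    intro i _
    fun_prop
  have hnorm : ∀ z, ‖z‖ = r → ‖h z‖ = ‖g z‖ := by
    intro z hz
    rw [hgq z, hh]
    simp only [norm_mul, norm_prod, norm_sub_circle hr0 _ z hz]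
  have hval : ‖h 0‖ = ‖g 0‖ * Real.exp (∑ n ∈ Finset.range N, (t - 1 - (n : ℝ) / 2)) := by
    rw [hgq 0, hh]
    simp only [norm_mul, norm_prod, mul_zero, zero_div, sub_zero, zero_sub, norm_neg, hl,
      Complex.norm_real, Real.norm_of_nonneg hr0.le]
    rw [Real.exp_sum, mul_assoc, ← Finset.prod_mul_distrib]
    congr 1
    apply Finset.prod_congr rfl
    intro n _
    rw [hr, ← Real.exp_add]
    congr 1; ring
  have hcirc : ∀ s, ‖circleMap 0 r s‖ = r := by intro s; simp [hr0.le]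
  have e1 : ∫ s in (-Real.pi)..Real.pi, ‖h (circleMap 0 r s)‖ =
      ∫ s in (-Real.pi)..Real.pi, ‖g (circleMap 0 r s)‖ := by
    congr 1; ext s; exact hnorm _ (hcirc s)
  have e2 := mean_lower hhd r
  rw [e1] at e2
  have hM : ‖g 0‖ * Real.exp (t ^ 2 - 3 / 2 * t) ≤ ‖h 0‖ := by
    rw [hval, sum_exponent]
    apply mul_le_mul_of_nonneg_left (Real.exp_le_exp.2 ?_) (norm_nonneg _)
    nlinarith [mul_nonneg (sub_nonneg.2 hN1) (sub_nonneg.2 hN2.le)]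
  have hc : Continuous (fun s => ‖g (circleMap 0 r s)‖) :=
    (hg.continuous.comp (continuous_circleMap 0 r)).norm
  apply mean_rpow_lower hc (fun s => norm_nonneg _) hp
  · have := norm_pos_iff.2 hg0
    positivity
  · refine le_trans ?_ e2
    gcongr

lemma phi_eq {z : ℂ} (hz : 1 ≤ ‖z‖) : phi 1 z = (Real.log ‖z‖) ^ 2 := by
  unfold phi logPlus
  rw [max_eq_left (Real.log_nonneg hz), one_mul]

lemma uniq_nat (p : ℝ) (hp : 1 ≤ p) (hp' : p < 4 / 3) {lam : ℕ → ℂ}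
    (hl : ∀ n, ‖lam n‖ = Real.exp (1 + (n : ℝ) / 2)) {f : ℂ → ℂ} (hf : Differentiable ℂ f)
    (hfin : fockNormP 1 p f < ⊤) (h0 : ∀ n, f (lam n) = 0) : f = 0 := by
  by_contra hne
  obtain ⟨k, g, hg, hg0, hfg⟩ := entire_pow_factor hf hne
  have hgl : ∀ n, g (lam n) = 0 := by
    intro n
    have h1 := hfg (lam n)
    rw [h0] at h1
    rcases mul_eq_zero.1 h1.symm with h | h
    · have h2 : lam n = 0 := by
        by_contra h3
        exact pow_ne_zero k h3 h
      have h3 := hl n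
      rw [h2, norm_zero] at h3
      exact absurd h3 (Real.exp_pos _).ne
    · exact h
  have hp0 : 0 ≤ p := by linarith
  set c : ℝ := 2 * Real.pi * ‖g 0‖ ^ p with hc
  have hcpos : 0 < c := by
    have := norm_pos_iff.2 hg0
    positivity
  set F : ℂ → ℝ := fun z => (‖f z‖ * Real.exp (-(phi 1 z))) ^ p with hF
  have hphim : Measurable (phi 1) := by
    unfold phi logPlus
    fun_prop
  have hFm : Measurable (fun z => ENNReal.ofReal (F z)) := by
    have := hf.continuous.measurable
    fun_prop
  -- lower bound for the inner integral
  have inner : ∀ r ∈ Set.Ioi (Real.exp 1), ENNReal.ofReal (c * r⁻¹) ≤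
      ∫⁻ s in Set.Ioo (-Real.pi) Real.pi,
        ENNReal.ofReal r * ENNReal.ofReal (F (Complex.polarCoord.symm (r, s))) := by
    intro r hr
    have hr0 : 0 < r := (Real.exp_pos 1).trans hr
    have hr1 : 1 ≤ r := by
      have := Real.one_le_exp (zero_le_one' ℝ)
      exact this.trans (le_of_lt hr)
    have ht : 1 ≤ Real.log r := (Real.le_log_iff_exp_le hr0).2 (le_of_lt hr)
    have key := circle_lower_s14 hg hl hgl hg0 hp ht
    rw [Real.exp_log hr0] at key
    set t := Real.log r with htdef
    have hcm : ∀ s, Complex.polarCoord.symm (r, s) = circleMap 0 r s := by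
      intro s
      rw [Complex.polarCoord_symm_apply, circleMap, Complex.exp_mul_I]
      simp
    have hcirc : ∀ s, ‖circleMap 0 r s‖ = r := by intro s; simp [hr0.le]
    have hlow : ∀ s, (r * Real.exp (-t ^ 2) ^ p) * ‖g (circleMap 0 r s)‖ ^ p ≤
        r * F (circleMap 0 r s) := by
      intro s
      simp only [hF]
      rw [phi_eq (by rw [hcirc]; exact hr1), hcirc, Real.mul_rpow (norm_nonneg _) (Real.exp_pos _).le,
        hfg, norm_mul, norm_pow, hcirc, mul_assoc, mul_comm (Real.exp _ ^ p)]
      gcongr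
      apply le_mul_of_one_le_left (norm_nonneg _)
      exact one_le_pow₀ hr1
    have hgc : Continuous (fun s => (r * Real.exp (-t ^ 2) ^ p) * ‖g (circleMap 0 r s)‖ ^ p) := by
      apply continuous_const.mul
      exact ((hg.continuous.comp (continuous_circleMap 0 r)).norm).rpow_const (fun t => Or.inr hp0)
    calc ENNReal.ofReal (c * r⁻¹)
        ≤ ENNReal.ofReal (∫ s in (-Real.pi)..Real.pi,
            (r * Real.exp (-t ^ 2) ^ p) * ‖g (circleMap 0 r s)‖ ^ p) := by
          apply ENNReal.ofReal_le_ofReal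
          rw [intervalIntegral.integral_const_mul]
          refine le_trans ?_ (mul_le_mul_of_nonneg_left key (by positivity))
          rw [Real.mul_rpow (norm_nonneg _) (Real.exp_pos _).le, ← Real.exp_mul, ← Real.exp_mul]
          have e : r * Real.exp (-t ^ 2 * p) *
              (2 * Real.pi * (‖g 0‖ ^ p * Real.exp ((t ^ 2 - 3 / 2 * t) * p))) =
              c * Real.exp (t + (-t ^ 2 * p) + (t ^ 2 - 3 / 2 * t) * p) := by
            rw [Real.exp_add, Real.exp_add, htdef, Real.exp_log hr0, hc]; ring
          rw [e]
          have e3 : r⁻¹ = Real.exp (-t) := by rw [Real.exp_neg, htdef, Real.exp_log hr0]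
          rw [e3]
          gcongr
          nlinarith
      _ = ∫⁻ s in Set.Ioo (-Real.pi) Real.pi,
            ENNReal.ofReal ((r * Real.exp (-t ^ 2) ^ p) * ‖g (circleMap 0 r s)‖ ^ p) := by
          rw [intervalIntegral.integral_of_le (by linarith [Real.pi_pos]),
            MeasureTheory.integral_Ioc_eq_integral_Ioo,
            MeasureTheory.ofReal_integral_eq_lintegral_ofReal]
          · exact (hgc.integrableOn_Icc).mono_set Set.Ioo_subset_Icc_self
          · exact Filter.Eventually.of_forall fun s => by positivity
      _ ≤ _ := by
          apply lintegral_mono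
          intro s
          simp only
          rw [hcm, ← ENNReal.ofReal_mul hr0.le]
          exact ENNReal.ofReal_le_ofReal (hlow s)
  have hpolar := Complex.lintegral_comp_polarCoord_symm (fun z => ENNReal.ofReal (F z))
  have hfin' : (∫⁻ z : ℂ, ENNReal.ofReal (F z)) < ⊤ := hfin
  rw [← hpolar] at hfin'
  have htop : (∫⁻ r in Set.Ioi (Real.exp 1), ENNReal.ofReal (c * r⁻¹)) < ⊤ := by
    refine lt_of_le_of_lt ?_ hfin'
    calc (∫⁻ r in Set.Ioi (Real.exp 1), ENNReal.ofReal (c * r⁻¹))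
        ≤ ∫⁻ r in Set.Ioi (Real.exp 1), ∫⁻ s in Set.Ioo (-Real.pi) Real.pi,
          ENNReal.ofReal r * ENNReal.ofReal (F (Complex.polarCoord.symm (r, s))) :=
          setLIntegral_mono' measurableSet_Ioi inner
      _ ≤ ∫⁻ r in Set.Ioi 0, ∫⁻ s in Set.Ioo (-Real.pi) Real.pi,
          ENNReal.ofReal r * ENNReal.ofReal (F (Complex.polarCoord.symm (r, s))) :=
          lintegral_mono_set (Set.Ioi_subset_Ioi (Real.exp_pos 1).le)
      _ = _ := by
          have hpm : Measurable (fun x : ℝ × ℝ => Complex.polarCoord.symm x) := by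
            simp only [Complex.polarCoord_symm_apply]
            fun_prop
          rw [polarCoord_target, Measure.volume_eq_prod, ← Measure.prod_restrict,
            lintegral_prod]
          · rfl
          · apply Measurable.aemeasurable
            exact (ENNReal.measurable_ofReal.comp measurable_fst).mul (hFm.comp hpm)
  have hint : IntegrableOn (fun r : ℝ => c * r⁻¹) (Set.Ioi (Real.exp 1)) := by
    refine ⟨by fun_prop, ?_⟩
    rw [hasFiniteIntegral_iff_ofReal]
    · exact htop
    · filter_upwards [ae_restrict_mem measurableSet_Ioi] with r hr
      have : 0 < r := (Real.exp_pos 1).trans hr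
      simp only [Pi.zero_apply]
      positivity
  have h2 := hint.const_mul c⁻¹
  apply not_integrableOn_Ioi_inv (a := Real.exp 1)
  refine h2.congr ?_
  filter_upwards with r
  field_simp

lemma exists_prod_bound : ∃ C : ℝ, 0 < C ∧ ∀ t : ℝ, 1 ≤ t → ∀ K : ℕ,
    ∏ n ∈ Finset.range K, (1 + Real.exp (t - 1 - (n : ℝ) / 2)) ≤
      C * Real.exp (t ^ 2 - 3 / 2 * t) := by
  have hsum : Summable (fun k : ℕ => Real.exp (-(k : ℝ) / 2)) := by
    have h := summable_geometric_of_lt_one (Real.exp_pos (-1 / 2)).le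
      (Real.exp_lt_one_iff.2 (by norm_num : (-1 / 2 : ℝ) < 0))
    refine h.congr fun k => ?_
    rw [← Real.exp_nat_mul]
    congr 1; ring
  set S := ∑' k : ℕ, Real.exp (-(k : ℝ) / 2) with hS
  have hle : ∀ K : ℕ, ∑ k ∈ Finset.range K, Real.exp (-(k : ℝ) / 2) ≤ S := fun K =>
    hsum.sum_le_tsum _ (fun i _ => (Real.exp_pos _).le)
  refine ⟨Real.exp (S + S + 9 / 16), Real.exp_pos _, fun t ht K => ?_⟩
  obtain ⟨N, hN1, hN2⟩ : ∃ N : ℕ, (N : ℝ) ≤ 2 * t - 1 ∧ 2 * t - 1 < N + 1 :=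
    ⟨⌊2 * t - 1⌋₊, Nat.floor_le (by linarith), Nat.lt_floor_add_one _⟩
  have hone : ∀ x : ℝ, 1 + Real.exp x ≤ Real.exp (Real.exp x) := fun x => by
    have := Real.add_one_le_exp (Real.exp x); linarith
  have hmono : ∏ n ∈ Finset.range K, (1 + Real.exp (t - 1 - (n : ℝ) / 2)) ≤
      ∏ n ∈ Finset.range (N + K), (1 + Real.exp (t - 1 - (n : ℝ) / 2)) := by
    apply Finset.prod_le_prod_of_subset_of_one_le
    · exact Finset.range_mono (by omega)
    · intro i _; positivity
    · intro i _ _; have := Real.exp_pos (t - 1 - (i : ℝ) / 2); linarith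
  refine hmono.trans ?_
  rw [Finset.prod_range_add]
  have hsecond : ∏ k ∈ Finset.range K, (1 + Real.exp (t - 1 - ((N + k : ℕ) : ℝ) / 2)) ≤
      Real.exp S := by
    calc _ ≤ ∏ k ∈ Finset.range K, Real.exp (Real.exp (-(k : ℝ) / 2)) := by
          apply Finset.prod_le_prod
          · intro i _; positivity
          · intro k _
            refine le_trans ?_ (hone _)
            have : t - 1 - ((N + k : ℕ) : ℝ) / 2 ≤ -(k : ℝ) / 2 := by push_cast; linarith
            have := Real.exp_le_exp.2 this
            linarith
      _ = Real.exp (∑ k ∈ Finset.range K, Real.exp (-(k : ℝ) / 2)) := (Real.exp_sum _ _).symm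
      _ ≤ _ := Real.exp_le_exp.2 (hle K)
  have hfirst : ∏ n ∈ Finset.range N, (1 + Real.exp (t - 1 - (n : ℝ) / 2)) ≤
      Real.exp (t ^ 2 - 3 / 2 * t + 9 / 16) * Real.exp S := by
    calc _ ≤ ∏ n ∈ Finset.range N, (Real.exp (t - 1 - (n : ℝ) / 2) *
            Real.exp (Real.exp (-((N - 1 - n : ℕ) : ℝ) / 2))) := by
          apply Finset.prod_le_prod
          · intro i _; positivity
          · intro n hn
            rw [Finset.mem_range] at hn
            have e : 1 + Real.exp (t - 1 - (n : ℝ) / 2) = Real.exp (t - 1 - (n : ℝ) / 2) *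
                (1 + Real.exp (-(t - 1 - (n : ℝ) / 2))) := by
              rw [mul_add, ← Real.exp_add]; simp; ring
            rw [e]
            apply mul_le_mul_of_nonneg_left _ (Real.exp_pos _).le
            refine le_trans ?_ (hone _)
            have : -(t - 1 - (n : ℝ) / 2) ≤ -((N - 1 - n : ℕ) : ℝ) / 2 := by
              rw [Nat.cast_sub (by omega), Nat.cast_sub (by omega)]; push_cast; linarith
            have := Real.exp_le_exp.2 this
            linarith
      _ = Real.exp (N * t - 3 * N / 4 - (N : ℝ) ^ 2 / 4) *
            Real.exp (∑ k ∈ Finset.range N, Real.exp (-(k : ℝ) / 2)) := by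
          rw [Finset.prod_mul_distrib, ← Real.exp_sum, ← Real.exp_sum, sum_exponent,
            Finset.sum_range_reflect (fun k : ℕ => Real.exp (-(k : ℝ) / 2)) N]
      _ ≤ _ := by
          apply mul_le_mul _ (Real.exp_le_exp.2 (hle N)) (Real.exp_pos _).le (Real.exp_pos _).le
          apply Real.exp_le_exp.2
          nlinarith [sq_nonneg ((N : ℝ) / 2 - (t - 3 / 4))]
  calc _ ≤ (Real.exp (t ^ 2 - 3 / 2 * t + 9 / 16) * Real.exp S) * Real.exp S :=
        mul_le_mul hfirst hsecond (Finset.prod_nonneg fun i _ => by positivity) (by positivity)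
    _ = _ := by
        rw [← Real.exp_add, ← Real.exp_add, ← Real.exp_add]; congr 1; ring

/-- Infinite product with zeros at the inverses of `a n`. -/
def canonProd (a : ℕ → ℂ) (z : ℂ) : ℂ := ∏' n, (1 + -(a n * z))

lemma canonProd_summable {a : ℕ → ℂ} (ha : Summable fun n => ‖a n‖) (z : ℂ) :
    Summable fun n => ‖-(a n * z)‖ := by
  simpa using ha.mul_right ‖z‖

lemma canonProd_multipliable {a : ℕ → ℂ} (ha : Summable fun n => ‖a n‖) (z : ℂ) :
    Multipliable fun n => (1 + -(a n * z)) :=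
  multipliable_one_add_of_summable (canonProd_summable ha z)

lemma canonProd_differentiable {a : ℕ → ℂ} (ha : Summable fun n => ‖a n‖) :
    Differentiable ℂ (canonProd a) := by
  intro z
  have h := Summable.hasProdLocallyUniformlyOn_nat_one_add (f := fun n z => -(a n * z))
    (K := Metric.ball (0 : ℂ) (‖z‖ + 1)) Metric.isOpen_ball (ha.mul_right (‖z‖ + 1))
    (Filter.Eventually.of_forall fun n x hx => by
      rw [norm_neg, norm_mul]
      have := mem_ball_zero_iff.1 hx
      gcongr)
    (fun n => by fun_prop)
  have h2 := h.tendstoLocallyUniformlyOn_finsetRange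
  have h3 := h2.differentiableOn (Filter.Eventually.of_forall fun N => by
    apply DifferentiableOn.fun_finsetProd
    intro i _
    fun_prop) Metric.isOpen_ball
  exact h3.differentiableAt (Metric.isOpen_ball.mem_nhds (by simp))

lemma canonProd_ne_zero {a : ℕ → ℂ} (ha : Summable fun n => ‖a n‖) {z : ℂ}
    (h : ∀ n, a n * z ≠ 1) : canonProd a z ≠ 0 := by
  refine tprod_one_add_ne_zero_of_summable (fun i h0 => h i ?_) (canonProd_summable ha z)
  linear_combination -h0

lemma update_summable {a : ℕ → ℂ} (ha : Summable fun n => ‖a n‖) (k : ℕ) :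
    Summable fun n => ‖Function.update a k 0 n‖ := by
  refine ha.of_nonneg_of_le (fun n => norm_nonneg _) fun n => ?_
  by_cases h : n = k
  · subst h; simp
  · simp [h]

lemma canonProd_factor {a : ℕ → ℂ} (ha : Summable fun n => ‖a n‖) (k : ℕ) (z : ℂ) :
    canonProd a z = (1 - a k * z) * canonProd (Function.update a k 0) z := by
  have e : Function.update (fun n => 1 + -(a n * z)) k 1 =
      fun n => 1 + -(Function.update a k 0 n * z) := by
    ext n
    by_cases h : n = k
    · subst h; simp
    · simp [h]
  unfold canonProd
  rw [Multipliable.tprod_eq_mul_tprod_ite' k (by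
    rw [e]; exact canonProd_multipliable (update_summable ha k) z), ← sub_eq_add_neg]
  congr 1
  refine tprod_congr fun n => ?_
  by_cases h : n = k
  · subst h; simp
  · simp [h]

lemma canonProd_bound {lam : ℕ → ℂ} (hl : ∀ n, ‖lam n‖ = Real.exp (1 + (n : ℝ) / 2)) (m : ℕ)
    (ha : Summable fun n => ‖Function.update (fun n => (lam n)⁻¹) m 0 n‖) :
    ∃ C : ℝ, 0 < C ∧ ∀ z : ℂ, Real.exp 1 ≤ ‖z‖ →
      ‖canonProd (Function.update (fun n => (lam n)⁻¹) m 0) z‖ * Real.exp (-(phi 1 z)) ≤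
        C * ‖z‖ ^ (-(5 / 2) : ℝ) := by
  obtain ⟨C, hC, hb⟩ := exists_prod_bound
  refine ⟨C * Real.exp (1 + (m : ℝ) / 2), by positivity, fun z hz => ?_⟩
  set r := ‖z‖ with hr
  have hr0 : 0 < r := (Real.exp_pos 1).trans_le hz
  have hr1 : 1 ≤ r := (Real.one_le_exp (zero_le_one' ℝ)).trans hz
  set t := Real.log r with ht
  have ht1 : 1 ≤ t := (Real.le_log_iff_exp_le hr0).2 hz
  have hrt : r = Real.exp t := (Real.exp_log hr0).symm
  set a := Function.update (fun n => (lam n)⁻¹) m 0 with hadef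
  have hfin : ∀ K, m < K → ‖∏ n ∈ Finset.range K, (1 + -(a n * z))‖ ≤
      C * Real.exp (t ^ 2 - 3 / 2 * t) * Real.exp (-(t - 1 - (m : ℝ) / 2)) := by
    intro K hK
    rw [Real.exp_neg, ← div_eq_mul_inv, le_div_iff₀ (Real.exp_pos _)]
    refine le_trans ?_ (hb t ht1 K)
    have hm : m ∈ Finset.range K := Finset.mem_range.2 hK
    rw [norm_prod, ← Finset.prod_erase_mul _ _ hm, ← Finset.prod_erase_mul (Finset.range K)
      (fun n : ℕ => 1 + Real.exp (t - 1 - (n : ℝ) / 2)) hm]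
    have h1 : ‖1 + -(a m * z)‖ = 1 := by simp [hadef]
    rw [h1, mul_one]
    apply mul_le_mul
    · apply Finset.prod_le_prod (fun i _ => norm_nonneg _)
      intro n hn
      have hne := Finset.ne_of_mem_erase hn
      refine (norm_add_le _ _).trans ?_
      rw [norm_neg, norm_mul, norm_one, ← hr, hadef, Function.update_of_ne hne, norm_inv, hl, hrt,
        ← Real.exp_neg, ← Real.exp_add]
      apply le_of_eq
      congr 2
      ring
    · linarith
    · exact (Real.exp_pos _).le
    · exact Finset.prod_nonneg fun i _ => by positivity
  have hlim : ‖canonProd a z‖ ≤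
      C * Real.exp (t ^ 2 - 3 / 2 * t) * Real.exp (-(t - 1 - (m : ℝ) / 2)) := by
    have h1 := ((canonProd_multipliable ha z).hasProd.tendsto_prod_nat).norm
    refine le_of_tendsto h1 ?_
    filter_upwards [Filter.eventually_gt_atTop m] with K hK using hfin K hK
  rw [phi_eq hr1, ← hr, ← ht]
  refine (mul_le_mul_of_nonneg_right hlim (Real.exp_pos _).le).trans (le_of_eq ?_)
  rw [hrt, ← Real.exp_mul, mul_assoc, mul_assoc, mul_assoc, ← Real.exp_add, ← Real.exp_add,
    ← Real.exp_add]
  congr 2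
  ring

lemma fock_of_bound {f : ℂ → ℂ} (hf : Differentiable ℂ f) {p C : ℝ} (hp : 1 ≤ p) (hC : 0 < C)
    (hb : ∀ z : ℂ, Real.exp 1 ≤ ‖z‖ →
      ‖f z‖ * Real.exp (-(phi 1 z)) ≤ C * ‖z‖ ^ (-(5 / 2) : ℝ)) :
    fockNormP 1 p f < ⊤ := by
  obtain ⟨B, hB⟩ := (isCompact_closedBall (0 : ℂ) (Real.exp 1)).exists_bound_of_continuousOn
    hf.continuous.continuousOn
  have hB0 : 0 ≤ B := (norm_nonneg _).trans (hB 0 (by simp [(Real.exp_pos 1).le]))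
  set D : ℝ := C * 2 ^ (5 / 2 : ℝ) + B * (1 + Real.exp 1) ^ (5 / 2 : ℝ) with hD
  have hD0 : 0 < D := by positivity
  have hbound : ∀ z : ℂ, ‖f z‖ * Real.exp (-(phi 1 z)) ≤ D * (1 + ‖z‖) ^ (-(5 / 2) : ℝ) := by
    intro z
    have hz1 : 0 < 1 + ‖z‖ := by positivity
    rw [Real.rpow_neg hz1.le, ← div_eq_mul_inv, le_div_iff₀ (by positivity)]
    rcases le_total (Real.exp 1) ‖z‖ with hz | hz
    · have hr1 : 1 ≤ ‖z‖ := (Real.one_le_exp (zero_le_one' ℝ)).trans hz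
      have hr0 : 0 < ‖z‖ := by linarith
      calc _ ≤ C * ‖z‖ ^ (-(5 / 2) : ℝ) * (2 * ‖z‖) ^ (5 / 2 : ℝ) := by
            apply mul_le_mul (hb z hz) _ (by positivity) (by positivity)
            apply Real.rpow_le_rpow (by positivity) (by linarith) (by norm_num)
        _ = C * 2 ^ (5 / 2 : ℝ) := by
            rw [Real.mul_rpow (by norm_num) hr0.le, Real.rpow_neg hr0.le]
            have : ‖z‖ ^ (5 / 2 : ℝ) ≠ 0 := by positivity
            field_simp
        _ ≤ D := by rw [hD]; have : 0 ≤ B * (1 + Real.exp 1) ^ (5 / 2 : ℝ) := by positivity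
                    linarith
    · have h1 : Real.exp (-(phi 1 z)) ≤ 1 := by
        apply Real.exp_le_one_iff.2
        unfold phi
        have := sq_nonneg (logPlus ‖z‖)
        linarith
      calc _ ≤ (B * 1) * (1 + Real.exp 1) ^ (5 / 2 : ℝ) := by
            apply mul_le_mul
            · exact mul_le_mul (hB z (by simpa using hz)) h1 (Real.exp_pos _).le hB0
            · apply Real.rpow_le_rpow (by positivity) (by linarith) (by norm_num)
            · positivity
            · positivity
        _ ≤ D := by rw [hD, mul_one]; have : 0 ≤ C * 2 ^ (5 / 2 : ℝ) := by positivity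
                    linarith
  have hfinal : ∀ z : ℂ, (‖f z‖ * Real.exp (-(phi 1 z))) ^ p ≤
      D ^ p * (1 + ‖z‖) ^ (-(5 / 2) : ℝ) := by
    intro z
    have hz1 : 1 ≤ 1 + ‖z‖ := by linarith [norm_nonneg z]
    refine (Real.rpow_le_rpow (by positivity) (hbound z) (by linarith)).trans ?_
    rw [Real.mul_rpow hD0.le (by positivity), ← Real.rpow_mul (by positivity)]
    gcongr
    nlinarith
  unfold fockNormP
  calc _ ≤ ∫⁻ z : ℂ, ENNReal.ofReal (D ^ p) * ENNReal.ofReal ((1 + ‖z‖) ^ (-(5 / 2) : ℝ)) := by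
        apply lintegral_mono
        intro z
        simp only
        rw [← ENNReal.ofReal_mul (by positivity)]
        exact ENNReal.ofReal_le_ofReal (hfinal z)
    _ = ENNReal.ofReal (D ^ p) * ∫⁻ z : ℂ, ENNReal.ofReal ((1 + ‖z‖) ^ (-(5 / 2) : ℝ)) :=
        lintegral_const_mul' _ _ ENNReal.ofReal_ne_top
    _ < ⊤ := by
        apply ENNReal.mul_lt_top ENNReal.ofReal_lt_top
        apply finite_integral_one_add_norm
        rw [Complex.finrank_real_complex]
        norm_num

lemma zero_nat (p : ℝ) (hp : 1 ≤ p) {lam : ℕ → ℂ}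
    (hl : ∀ n, ‖lam n‖ = Real.exp (1 + (n : ℝ) / 2)) (m : ℕ) :
    ZeroSet p (Set.range lam \ {lam m}) := by
  have hinj : Function.Injective lam := by
    intro a b hab
    have := congrArg norm hab
    rw [hl, hl, Real.exp_eq_exp] at this
    have h2 : (a : ℝ) = b := by linarith
    exact_mod_cast h2
  have hl0 : ∀ n, lam n ≠ 0 := fun n h => by
    have := hl n
    rw [h, norm_zero] at this
    exact absurd this (Real.exp_pos _).ne
  have hsum : Summable (fun n => ‖(lam n)⁻¹‖) := by
    have h := (summable_geometric_of_lt_one (Real.exp_pos (-1 / 2)).le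
      (Real.exp_lt_one_iff.2 (by norm_num : (-1 / 2 : ℝ) < 0))).mul_left (Real.exp (-1))
    refine h.congr fun k => ?_
    rw [← Real.exp_nat_mul, norm_inv, hl, ← Real.exp_neg, ← Real.exp_add]
    congr 1; ring
  set a := Function.update (fun n => (lam n)⁻¹) m 0 with hadef
  have ha : Summable (fun n => ‖a n‖) := update_summable hsum m
  have hane : ∀ n, n ≠ m → a n = (lam n)⁻¹ := fun n hn => by simp [hadef, hn]
  have hone : ∀ n z, a n * z = 1 → n ≠ m ∧ z = lam n := by
    intro n z h
    have hn : n ≠ m := by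
      rintro rfl
      simp [hadef] at h
    refine ⟨hn, ?_⟩
    rw [hane n hn] at h
    have := hl0 n
    field_simp at h
    exact h
  have hd := canonProd_differentiable ha
  obtain ⟨C, hC, hb⟩ := canonProd_bound hl m ha
  refine ⟨canonProd a, ⟨hd, fock_of_bound hd hp hC hb⟩, ?_, ?_, ?_⟩
  · intro h
    exact canonProd_ne_zero ha (z := 0) (by simp) (by rw [h]; rfl)
  · intro z
    constructor
    · intro h
      by_contra hz
      refine canonProd_ne_zero ha (z := z) (fun n hn => hz ?_) h
      obtain ⟨h1, rfl⟩ := hone n z hn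
      exact ⟨⟨n, rfl⟩, fun h => h1 (hinj h)⟩
    · rintro ⟨⟨n, rfl⟩, hn⟩
      have hnm : n ≠ m := fun h => hn (by rw [h]; rfl)
      rw [canonProd_factor ha n, hane n hnm, inv_mul_cancel₀ (hl0 n), sub_self, zero_mul]
  · rintro z ⟨⟨n, rfl⟩, hn⟩
    have hnm : n ≠ m := fun h => hn (by rw [h]; rfl)
    have hb' := update_summable ha n
    have hd' := canonProd_differentiable hb'
    have hfun : canonProd a = fun z => (1 - a n * z) * canonProd (Function.update a n 0) z :=
      funext (canonProd_factor ha n)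
    have hder : HasDerivAt (canonProd a)
        ((-(a n)) * canonProd (Function.update a n 0) (lam n) +
          (1 - a n * lam n) * deriv (canonProd (Function.update a n 0)) (lam n)) (lam n) := by
      rw [hfun]
      refine HasDerivAt.mul ?_ (hd' _).hasDerivAt
      simpa using ((hasDerivAt_id (lam n)).const_mul (a n)).const_sub 1
    rw [hder.deriv, hane n hnm, inv_mul_cancel₀ (hl0 n), sub_self, zero_mul, add_zero]
    apply mul_ne_zero (neg_ne_zero.2 (inv_ne_zero (hl0 n)))
    apply canonProd_ne_zero hb'
    intro k hk
    by_cases hkn : k = n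
    · subst hkn; simp at hk
    · rw [Function.update_of_ne hkn] at hk
      exact hkn (hinj (hone k _ hk).2).symm

lemma LamSet_eq_range (θ : ℤ → ℝ) :
    LamSet θ 1 = Set.range (fun n : ℕ => lamPt θ ((n : ℤ) + 1)) := by
  ext w
  constructor
  · rintro ⟨n, hn, rfl⟩
    refine ⟨(n - 1).toNat, ?_⟩
    simp only
    congr 1
    omega
  · rintro ⟨n, rfl⟩
    exact ⟨(n : ℤ) + 1, by omega, rfl⟩

lemma norm_lamPt_nat (θ : ℤ → ℝ) (n : ℕ) :
    ‖lamPt θ ((n : ℤ) + 1)‖ = Real.exp (1 + (n : ℝ) / 2) := by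
  unfold lamPt
  rw [norm_mul, Complex.norm_exp_ofReal_mul_I, mul_one, Complex.norm_real,
    Real.norm_of_nonneg (Real.exp_pos _).le]
  congr 1
  push_cast
  ring

/-- for `1 ≤ p < 4/3`, `Λ_1` is a uniqueness set of zero excess
for `F^p_φ`. -/
theorem statement14 (p : ℝ) (hp : 1 ≤ p) (hp' : p < 4 / 3) (θ : ℤ → ℝ) :
    ExactUniquenessSet p (LamSet θ 1) := by
  rw [LamSet_eq_range]
  have hl := norm_lamPt_nat θ
  refine ⟨fun f hf h0 => uniq_nat p hp hp' hl hf.1 hf.2 fun n => h0 _ ⟨n, rfl⟩, ?_⟩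
  rintro _ ⟨m, rfl⟩
  exact zero_nat p hp hl m

end
end

section
/- Let 1 ≤ p < ∞ and let Λ ⊂ ℂ be a countable set. The following are equivalent: (1) there exists a constant C > 0 such that Σ_{λ∈Λ} (1+|λ|)² |f(λ) e^{−φ(λ)}|^p ≤ C ‖f‖_{p,φ}^p for every f ∈ F^p_φ; (2) Λ is a finite union of d_ρ-separated sets. -/
open MeasureTheory Complex
open scoped ENNReal
noncomputable section

lemma circle_mean (p : ℝ) (hp : 1 ≤ p) (g : ℂ → ℂ) (c : ℂ) (R : ℝ)
    (hd : DifferentiableOn ℂ g (Metric.ball c R)) (r : ℝ) (hr0 : 0 < r) (hr : r < R) :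
    ENNReal.ofReal (‖g c‖ ^ p) * ENNReal.ofReal (2 * Real.pi) ≤
      ∫⁻ θ in Set.Ioo (-Real.pi) Real.pi, ENNReal.ofReal (‖g (circleMap c r θ)‖ ^ p) := by
  have hpi := Real.pi_pos
  have hsub : Metric.closedBall c r ⊆ Metric.ball c R := Metric.closedBall_subset_ball hr
  have hcont : Continuous fun θ : ℝ => g (circleMap c r θ) := by
    have h1 : ContinuousOn g (Metric.ball c R) := hd.continuousOn
    refine h1.comp_continuous (continuous_circleMap c r) fun θ => ?_
    exact hsub (circleMap_mem_closedBall c hr0.le θ)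
  have hmean : Real.circleAverage g c r = g c := by
    have : DiffContOnCl ℂ g (Metric.ball c |r|) := by
      rw [abs_of_pos hr0]
      exact (hd.mono hsub).diffContOnCl_ball subset_rfl
    exact this.circleAverage
  have havg : g c = (2 * Real.pi)⁻¹ • ∫ θ in Set.Ioo (-Real.pi) Real.pi, g (circleMap c r θ) := by
    rw [← hmean, Real.circleAverage_eq_integral_add (-Real.pi),
      intervalIntegral.integral_comp_add_right (fun θ => g (circleMap c r θ)),
      intervalIntegral.integral_of_le (by linarith), ← integral_Ioc_eq_integral_Ioo]
    congr 3
    ring_nf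
  have hnorm : ‖g c‖ ≤ ⨍ θ in Set.Ioo (-Real.pi) Real.pi, ‖g (circleMap c r θ)‖ := by
    rw [setAverage_eq]
    have hv : (volume.real (Set.Ioo (-Real.pi) Real.pi)) = 2 * Real.pi := by
      simp [Measure.real, Real.volume_Ioo]; 
      rw [ENNReal.toReal_ofReal] <;> linarith
    rw [hv]
    conv_lhs => rw [havg]
    rw [norm_smul, smul_eq_mul, Real.norm_of_nonneg (by positivity)]
    gcongr
    exact norm_integral_le_integral_norm _
  have hint : ∀ h : ℝ → ℝ, Continuous h → IntegrableOn h (Set.Ioo (-Real.pi) Real.pi) := fun h hh =>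
    (hh.integrableOn_Icc).mono_set Set.Ioo_subset_Icc_self
  have hc2 : Continuous fun θ : ℝ => ‖g (circleMap c r θ)‖ ^ p :=
    hcont.norm.rpow_const fun _ => Or.inr (by linarith)
  have hJ := ConvexOn.map_set_average_le (μ := volume) (t := Set.Ioo (-Real.pi) Real.pi)
    (f := fun θ : ℝ => ‖g (circleMap c r θ)‖) (convexOn_rpow hp)
    (Real.continuous_rpow_const (by linarith)).continuousOn isClosed_Ici
    (by simp [hpi]) (by simp) (Filter.Eventually.of_forall fun θ => norm_nonneg _)
    (hint _ hcont.norm) (hint _ hc2)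
  have h3 : ‖g c‖ ^ p * (2 * Real.pi) ≤ ∫ θ in Set.Ioo (-Real.pi) Real.pi, ‖g (circleMap c r θ)‖ ^ p := by
    have hv : (volume.real (Set.Ioo (-Real.pi) Real.pi)) = 2 * Real.pi := by
      simp [Measure.real, Real.volume_Ioo]; 
      rw [ENNReal.toReal_ofReal] <;> linarith
    have h4 := (Real.rpow_le_rpow (norm_nonneg _) hnorm (by linarith : 0 ≤ p)).trans hJ
    rw [setAverage_eq, hv, smul_eq_mul] at h4
    rw [inv_mul_eq_div, le_div_iff₀ (by positivity)] at h4
    exact h4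
  rw [← ENNReal.ofReal_mul (by positivity), ← ofReal_integral_eq_lintegral_ofReal (hint _ hc2)
    (Filter.Eventually.of_forall fun θ => by positivity)]
  exact ENNReal.ofReal_le_ofReal h3

lemma disc_mean (p : ℝ) (hp : 1 ≤ p) (g : ℂ → ℂ) (hg : Measurable g) (c : ℂ) (R : ℝ)
    (hd : DifferentiableOn ℂ g (Metric.ball c R)) :
    ENNReal.ofReal (‖g c‖ ^ p) * volume (Metric.ball c R) ≤
      ∫⁻ z in Metric.ball c R, ENNReal.ofReal (‖g z‖ ^ p) := by
  have hm : Measurable fun z => ENNReal.ofReal (‖g z‖ ^ p) := by fun_prop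
  have key : ∀ F : ℂ → ℝ≥0∞, Measurable F → ∫⁻ z in Metric.ball c R, F z =
      ∫⁻ r in Set.Ioi (0:ℝ), ∫⁻ θ in Set.Ioo (-Real.pi) Real.pi, ENNReal.ofReal r *
        (Metric.ball c R).indicator F (circleMap c r θ) := by
    intro F hF
    have hFm : Measurable ((Metric.ball c R).indicator F) := hF.indicator measurableSet_ball
    rw [← lintegral_indicator measurableSet_ball, ← lintegral_add_left_eq_self _ c,
      ← Complex.lintegral_comp_polarCoord_symm]
    have : ∀ q : ℝ × ℝ, ENNReal.ofReal q.1 • (Metric.ball c R).indicator F (c + Complex.polarCoord.symm q)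
        = ENNReal.ofReal q.1 * (Metric.ball c R).indicator F (circleMap c q.1 q.2) := by
      intro q
      simp [circleMap, Complex.polarCoord_symm_apply, Complex.exp_mul_I]
    simp_rw [this]
    rw [polarCoord_target, Measure.volume_eq_prod, setLIntegral_prod]
    refine Measurable.aemeasurable ?_
    refine (by fun_prop : Measurable fun q : ℝ × ℝ => ENNReal.ofReal q.1).mul (hFm.comp ?_)
    simp only [circleMap]
    fun_prop
  rw [key _ hm, ← setLIntegral_const, key _ measurable_const]
  refine setLIntegral_mono' measurableSet_Ioi fun r hr => ?_
  rw [lintegral_const_mul' _ _ (by simp), lintegral_const_mul' _ _ (by simp)]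
  gcongr ENNReal.ofReal r * ?_
  have hr' : 0 < r := hr
  by_cases hrR : r < R
  · have hin : ∀ θ : ℝ, circleMap c r θ ∈ Metric.ball c R := fun θ => by
      simpa [dist_eq_norm, circleMap, abs_of_pos hr'] using hrR
    simp only [Set.indicator_of_mem (hin _)]
    refine le_trans (le_of_eq ?_) (circle_mean p hp g c R hd r hr' hrR)
    rw [setLIntegral_const, Real.volume_Ioo]
    ring_nf
  · have hin : ∀ θ : ℝ, circleMap c r θ ∉ Metric.ball c R := fun θ => by
      simpa [dist_eq_norm, circleMap, abs_of_pos hr'] using hrR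
    simp [Set.indicator_of_notMem (hin _)]

lemma local_comp (f : ℂ → ℂ) (hf : Differentiable ℂ f) (l : ℂ) (r : ℝ) (hr : r ≤ (1 + ‖l‖) / 4) :
    ∃ g : ℂ → ℂ, Measurable g ∧ DifferentiableOn ℂ g (Metric.ball l r) ∧
      ‖f l‖ * Real.exp (-(phi 1 l)) ≤ ‖g l‖ ∧
      ∀ z ∈ Metric.ball l r, ‖g z‖ ≤ Real.exp 9 * (‖f z‖ * Real.exp (-(phi 1 z))) := by
  by_cases hl : 2 ≤ ‖l‖
  · have hl0 : l ≠ 0 := by rintro rfl; simp at hl; linarith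
    have hln : 0 < ‖l‖ := by linarith
    set L : ℝ := Real.log ‖l‖ with hL
    have hLpos : 0 ≤ L := Real.log_nonneg (by linarith)
    refine ⟨fun z => f z * (z / l) ^ (((-(2 * L) : ℝ)) : ℂ) * ((Real.exp (-L ^ 2) : ℝ) : ℂ), ?_, ?_, ?_, ?_⟩
    · have := hf.continuous.measurable
      fun_prop
    · intro z hz
      have hz' : ‖z - l‖ < r := by simpa [dist_eq_norm] using hz
      have hslit : z / l ∈ slitPlane := by
        have h1 : z / l = 1 + (z - l) / l := by field_simp; ring
        rw [h1]
        refine mem_slitPlane_of_norm_lt_one ?_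
        rw [norm_div, div_lt_one hln]
        linarith
      have h2 : DifferentiableAt ℂ (fun z : ℂ => (z / l) ^ (((-(2 * L) : ℝ)) : ℂ)) z :=
        DifferentiableAt.cpow_const (by fun_prop) hslit
      exact ((hf z).mul h2 |>.mul_const _).differentiableWithinAt
    · simp only [div_self hl0, one_cpow, mul_one, norm_mul, Complex.norm_real]
      rw [Real.norm_of_nonneg (Real.exp_pos _).le]
      simp [phi, logPlus, ← hL, max_eq_left hLpos]
    · intro z hz
      have hz' : ‖z - l‖ < r := by simpa [dist_eq_norm] using hz
      have hzl : ‖l‖ - ‖z‖ ≤ ‖z - l‖ := by rw [norm_sub_rev]; exact norm_sub_norm_le _ _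
      have hzl2 : ‖z‖ - ‖l‖ ≤ ‖z - l‖ := norm_sub_norm_le _ _
      have hzpos : 0 < ‖z‖ := by linarith
      have hz1 : 1 ≤ ‖z‖ := by linarith
      have hz0 : z ≠ 0 := norm_pos_iff.mp hzpos
      set M : ℝ := Real.log ‖z‖ with hM
      have hMpos : 0 ≤ M := Real.log_nonneg hz1
      have hup : M - L ≤ 1 := by
        have h := Real.log_le_sub_one_of_pos (div_pos hzpos hln)
        rw [Real.log_div hzpos.ne' hln.ne'] at h
        have : ‖z‖ / ‖l‖ ≤ 2 := by rw [div_le_iff₀ hln]; linarith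
        linarith
      have hlo : L - M ≤ 1 := by
        have h := Real.log_le_sub_one_of_pos (div_pos hln hzpos)
        rw [Real.log_div hln.ne' hzpos.ne'] at h
        have : ‖l‖ / ‖z‖ ≤ 2 := by rw [div_le_iff₀ hzpos]; linarith
        linarith
      have hn : ‖(z / l) ^ (((-(2 * L) : ℝ)) : ℂ)‖ = Real.exp ((M - L) * (-(2 * L))) := by
        rw [Complex.norm_cpow_of_ne_zero (div_ne_zero hz0 hl0)]
        simp only [ofReal_re, ofReal_im, mul_zero, Real.exp_zero, div_one]
        rw [norm_div, Real.rpow_def_of_pos (div_pos hzpos hln), Real.log_div hzpos.ne' hln.ne']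
      rw [norm_mul, norm_mul, hn, Complex.norm_real, Real.norm_of_nonneg (Real.exp_pos _).le]
      simp only [phi, logPlus, ← hM, max_eq_left hMpos, one_mul]
      rw [mul_assoc, ← Real.exp_add, mul_left_comm, ← Real.exp_add]
      refine mul_le_mul_of_nonneg_left (Real.exp_le_exp.mpr ?_) (norm_nonneg _)
      nlinarith
  · refine ⟨f, hf.continuous.measurable, hf.differentiableOn, ?_, ?_⟩
    · refine mul_le_of_le_one_right (norm_nonneg _) ?_
      rw [Real.exp_le_one_iff]
      simp only [phi]; nlinarith [sq_nonneg (logPlus ‖l‖)]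
    · intro z hz
      have hz' : ‖z - l‖ < r := by simpa [dist_eq_norm] using hz
      have hzl2 : ‖z‖ - ‖l‖ ≤ ‖z - l‖ := norm_sub_norm_le _ _
      have hlp : logPlus ‖z‖ ≤ 3 := by
        refine max_le ?_ (by norm_num)
        have := Real.log_le_self (norm_nonneg z)
        linarith
      have hlp0 : 0 ≤ logPlus ‖z‖ := le_max_right _ _
      rw [mul_left_comm, ← Real.exp_add]
      refine le_mul_of_one_le_right (norm_nonneg _) ?_
      rw [Real.one_le_exp_iff]
      simp only [phi]; nlinarith

lemma local_est (p : ℝ) (hp : 1 ≤ p) (f : ℂ → ℂ) (hf : Differentiable ℂ f) (δ : ℝ) (hδ : 0 < δ)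
    (hδ' : δ ≤ 1 / 4) (l : ℂ) :
    ENNReal.ofReal ((1 + ‖l‖) ^ 2 * (‖f l‖ * Real.exp (-(phi 1 l))) ^ p) ≤
      ENNReal.ofReal ((Real.exp 9) ^ p / (δ ^ 2 * Real.pi)) *
        ∫⁻ z in Metric.ball l (δ * (1 + ‖l‖)),
          ENNReal.ofReal ((‖f z‖ * Real.exp (-(phi 1 z))) ^ p) := by
  have hpi := Real.pi_pos
  have hl0 := norm_nonneg l
  obtain ⟨g, hgm, hgd, hg1, hg2⟩ := local_comp f hf l (δ * (1 + ‖l‖)) (by nlinarith)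
  have h1 := disc_mean p hp g hgm l _ hgd
  have h2 : ∫⁻ z in Metric.ball l (δ * (1 + ‖l‖)), ENNReal.ofReal (‖g z‖ ^ p) ≤
      ENNReal.ofReal ((Real.exp 9) ^ p) * ∫⁻ z in Metric.ball l (δ * (1 + ‖l‖)),
          ENNReal.ofReal ((‖f z‖ * Real.exp (-(phi 1 z))) ^ p) := by
    rw [← lintegral_const_mul' _ _ (by simp)]
    refine setLIntegral_mono' measurableSet_ball fun z hz => ?_
    rw [← ENNReal.ofReal_mul (by positivity), ← Real.mul_rpow (by positivity) (by positivity)]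
    exact ENNReal.ofReal_le_ofReal (Real.rpow_le_rpow (norm_nonneg _) (hg2 z hz) (by linarith))
  have hvol : volume (Metric.ball l (δ * (1 + ‖l‖))) =
      ENNReal.ofReal (δ ^ 2 * Real.pi) * ENNReal.ofReal ((1 + ‖l‖) ^ 2) := by
    rw [Complex.volume_ball, ← ENNReal.ofReal_mul (by positivity), ← ENNReal.ofReal_pow (by positivity),
      ← ENNReal.ofReal_coe_nnreal, ← ENNReal.ofReal_mul (by positivity)]
    congr 1
    simp only [NNReal.coe_real_pi]
    ring
  have h3 := h1.trans h2
  rw [hvol] at h3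
  rw [div_eq_inv_mul, ENNReal.ofReal_mul (p := (δ ^ 2 * Real.pi)⁻¹) (by positivity), mul_assoc]
  calc _ ≤ ENNReal.ofReal ((1 + ‖l‖) ^ 2 * ‖g l‖ ^ p) := by
        refine ENNReal.ofReal_le_ofReal ?_
        gcongr
    _ = ENNReal.ofReal (δ ^ 2 * Real.pi)⁻¹ * (ENNReal.ofReal (‖g l‖ ^ p) *
        (ENNReal.ofReal (δ ^ 2 * Real.pi) * ENNReal.ofReal ((1 + ‖l‖) ^ 2))) := by
        rw [← ENNReal.ofReal_mul (by positivity), ← ENNReal.ofReal_mul (by positivity),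
          ← ENNReal.ofReal_mul (by positivity)]
        congr 1
        field_simp
    _ ≤ _ := by gcongr

lemma sep_est (p : ℝ) (hp : 1 ≤ p) (S : Set ℂ) (hS : S.Countable) (hsep : DRhoSeparated1 S) :
    ∃ C : ℝ, 0 < C ∧ ∀ f : ℂ → ℂ, Differentiable ℂ f →
      (∑' lam : S, ENNReal.ofReal
          ((1 + ‖(lam : ℂ)‖) ^ 2 *
            (‖f (lam : ℂ)‖ * Real.exp (-(phi 1 (lam : ℂ)))) ^ p)) ≤
        ENNReal.ofReal C * fockNormP 1 p f := by
  obtain ⟨ε, hε, h⟩ := hsep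
  have hpi := Real.pi_pos
  set δ : ℝ := min (1 / 4) (ε / 6) with hδdef
  have hδ : 0 < δ := by positivity
  have hδ1 : δ ≤ 1 / 4 := min_le_left _ _
  have hδ2 : δ ≤ ε / 6 := min_le_right _ _
  have h2 : ∀ a ∈ S, ∀ b ∈ S, a ≠ b → ‖a‖ ≤ ‖b‖ →
      Disjoint (Metric.ball a (δ * (1 + ‖a‖))) (Metric.ball b (δ * (1 + ‖b‖))) := by
    intro a ha b hb hab hle
    rw [Set.disjoint_left]
    intro z hza hzb
    have h1 := h a ha b hb hab
    have hs : Real.sqrt 2 ≤ 2 := by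
      rw [Real.sqrt_le_left (by norm_num)]; norm_num
    have hs0 : 0 < Real.sqrt 2 := by positivity
    have hmin : min (rho1 a) (rho1 b) = rho1 a := min_eq_left (by unfold rho1; gcongr)
    have ha0 := norm_nonneg a
    have hrho : ‖a‖ / 2 ≤ rho1 a := by unfold rho1; gcongr
    rw [dRho1, hmin, le_div_iff₀ (by linarith)] at h1
    have h3 : ‖a - b‖ < δ * (1 + ‖a‖) + δ * (1 + ‖b‖) := by
      have := dist_triangle_right a b z
      rw [dist_eq_norm] at this
      rw [Metric.mem_ball'] at hza hzb
      linarith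
    have h4 : ‖b‖ - ‖a‖ ≤ ‖a - b‖ := by rw [norm_sub_rev]; exact norm_sub_norm_le _ _
    have h5 : 1 + ‖b‖ ≤ 2 * (1 + ‖a‖) := by nlinarith
    nlinarith
  have hdisj : Pairwise (Function.onFun Disjoint fun a : S => Metric.ball (a : ℂ) (δ * (1 + ‖(a : ℂ)‖))) := by
    intro a b hab
    have hab' : (a : ℂ) ≠ b := fun h => hab (Subtype.ext h)
    rcases le_total ‖(a : ℂ)‖ ‖(b : ℂ)‖ with hle | hle
    · exact h2 a a.2 b b.2 hab' hle
    · exact (h2 b b.2 a a.2 hab'.symm hle).symm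
  refine ⟨(Real.exp 9) ^ p / (δ ^ 2 * Real.pi), by positivity, fun f hf => ?_⟩
  have : Countable S := hS.to_subtype
  refine (ENNReal.tsum_le_tsum fun l : S => local_est p hp f hf δ hδ hδ1 l).trans ?_
  rw [ENNReal.tsum_mul_left, ← lintegral_iUnion (fun _ => measurableSet_ball) hdisj]
  gcongr
  exact setLIntegral_le_lintegral _ _

lemma dir2 (p : ℝ) (hp : 1 ≤ p) (Λ : Set ℂ) (hΛ : Λ.Countable)
    (h : ∃ (m : ℕ) (Λs : Fin m → Set ℂ), (∀ i, DRhoSeparated1 (Λs i)) ∧ Λ = ⋃ i, Λs i) :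
    ∃ C : ℝ, 0 < C ∧ ∀ f : ℂ → ℂ, MemFock 1 p f →
      (∑' lam : Λ, ENNReal.ofReal
          ((1 + ‖(lam : ℂ)‖) ^ 2 *
            (‖f (lam : ℂ)‖ * Real.exp (-(phi 1 (lam : ℂ)))) ^ p)) ≤
        ENNReal.ofReal C * fockNormP 1 p f := by
  obtain ⟨m, Λs, hsep, rfl⟩ := h
  choose C hC hCf using fun i => sep_est p hp (Λs i) (hΛ.mono (Set.subset_iUnion _ i)) (hsep i)
  have hsum : 0 ≤ ∑ i, C i := Finset.sum_nonneg fun i _ => (hC i).le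
  refine ⟨∑ i, C i + 1, by linarith, fun f hf => ?_⟩
  refine (ENNReal.tsum_iUnion_le (fun lam : ℂ => ENNReal.ofReal
          ((1 + ‖(lam : ℂ)‖) ^ 2 *
            (‖f (lam : ℂ)‖ * Real.exp (-(phi 1 (lam : ℂ)))) ^ p)) Λs).trans ?_
  refine (Finset.sum_le_sum fun i _ => hCf i f hf.1).trans ?_
  rw [← Finset.sum_mul, ← ENNReal.ofReal_sum_of_nonneg fun i _ => (hC i).le]
  gcongr
  linarith

lemma norm_le_exp_logPlus (z : ℂ) : ‖z‖ ≤ Real.exp (logPlus ‖z‖) := by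
  rcases (norm_nonneg z).eq_or_lt with h | h
  · rw [← h]; positivity
  · calc ‖z‖ = Real.exp (Real.log ‖z‖) := (Real.exp_log h).symm
      _ ≤ _ := Real.exp_le_exp.mpr (le_max_left _ _)

lemma exp_logPlus_of_pos (z : ℂ) (h : 0 < logPlus ‖z‖) : ‖z‖ = Real.exp (logPlus ‖z‖) := by
  have h1 : logPlus ‖z‖ = Real.log ‖z‖ := by
    unfold logPlus at h ⊢
    rcases lt_max_iff.mp h with h | h
    · exact max_eq_left h.le
    · exact absurd h (lt_irrefl _)
  rw [h1, Real.exp_log]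
  rcases (norm_nonneg z).eq_or_lt with h2 | h2
  · rw [h1, ← h2] at h; simp at h
  · exact h2

lemma exp_logPlus_le (z : ℂ) : Real.exp (logPlus ‖z‖) ≤ 1 + ‖z‖ := by
  have h0 : 0 ≤ logPlus ‖z‖ := le_max_right _ _
  rcases h0.eq_or_lt with h | h
  · rw [← h]; simp
  · rw [← exp_logPlus_of_pos z h]; linarith

lemma test_upper (n : ℕ) (z : ℂ) :
    ‖z ^ n‖ * Real.exp (-(phi 1 z)) ≤
      Real.exp ((n : ℝ) ^ 2 / 4) * (16 * Real.exp 4 * (1 + ‖Real.exp (-((n : ℝ) / 2)) • z‖) ^ (-4 : ℝ)) := by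
  set s := logPlus ‖z‖ with hs
  have hs0 : 0 ≤ s := le_max_right _ _
  have h1 : ‖z ^ n‖ ≤ Real.exp (n * s) := by
    rw [norm_pow, Real.exp_nat_mul]
    exact pow_le_pow_left₀ (norm_nonneg _) (norm_le_exp_logPlus z) n
  have h2 : ‖z ^ n‖ * Real.exp (-(phi 1 z)) ≤ Real.exp ((n : ℝ) ^ 2 / 4) * Real.exp (-(s - n / 2) ^ 2) := by
    calc _ ≤ Real.exp (n * s) * Real.exp (-(phi 1 z)) := by gcongr
      _ = _ := by
        rw [← Real.exp_add, ← Real.exp_add]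
        congr 1
        simp only [phi, ← hs]
        ring
  refine h2.trans ?_
  gcongr ?_ * ?_
  set u := s - n / 2 with hu
  have hy : ‖Real.exp (-((n : ℝ) / 2)) • z‖ ≤ Real.exp u := by
    rw [norm_smul, Real.norm_of_nonneg (Real.exp_pos _).le]
    calc _ ≤ Real.exp (-((n : ℝ) / 2)) * Real.exp s := by
          gcongr; exact norm_le_exp_logPlus z
      _ = _ := by rw [← Real.exp_add]; congr 1; rw [hu]; ring
  set y := ‖Real.exp (-((n : ℝ) / 2)) • z‖ with hydef
  have hy0 : 0 ≤ y := norm_nonneg _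
  rw [Real.rpow_neg (by positivity), ← div_eq_mul_inv, le_div_iff₀ (by positivity)]
  have h4 : (1 + y) ^ (4 : ℝ) = (1 + y) ^ 4 := by norm_cast
  rw [h4]
  rcases le_total u 0 with h | h
  · have : y ≤ 1 := hy.trans (Real.exp_le_one_iff.mpr h)
    calc Real.exp (-u ^ 2) * (1 + y) ^ 4 ≤ 1 * (1 + 1) ^ 4 := by
          gcongr
          rw [Real.exp_le_one_iff]; nlinarith
      _ ≤ 16 * Real.exp 4 := by
          have := Real.add_one_le_exp (4 : ℝ)
          linarith
  · have : 1 + y ≤ 2 * Real.exp u := by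
      have := Real.add_one_le_exp u
      linarith
    calc Real.exp (-u ^ 2) * (1 + y) ^ 4 ≤ Real.exp (4 - 4 * u) * (2 * Real.exp u) ^ 4 := by
          gcongr
          nlinarith [sq_nonneg (u - 2)]
      _ = 16 * Real.exp 4 := by
          rw [mul_pow, ← Real.exp_nat_mul, mul_left_comm, ← Real.exp_add]
          push_cast
          ring_nf

lemma test_norm (p : ℝ) (hp : 1 ≤ p) : ∃ B : ℝ, 0 < B ∧ ∀ n : ℕ,
    fockNormP 1 p (fun z => z ^ n) ≤ ENNReal.ofReal (B * (Real.exp n * Real.exp ((n : ℝ) ^ 2 / 4) ^ p)) := by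
  have hI : (∫⁻ x : ℂ, ENNReal.ofReal ((1 + ‖x‖) ^ (-(4 * p)))) < ∞ := by
    apply finite_integral_one_add_norm
    simp only [Complex.finrank_real_complex]
    push_cast; linarith
  set I := ∫⁻ x : ℂ, ENNReal.ofReal ((1 + ‖x‖) ^ (-(4 * p))) with hIdef
  refine ⟨(16 * Real.exp 4) ^ p * (I.toReal + 1), by positivity, fun n => ?_⟩
  have hsc : ∫⁻ z : ℂ, ENNReal.ofReal ((1 + ‖Real.exp (-((n : ℝ) / 2)) • z‖) ^ (-(4 * p))) =
      ENNReal.ofReal (Real.exp n) * I := by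
    have hm : Measurable fun x : ℂ => ENNReal.ofReal ((1 + ‖x‖) ^ (-(4 * p))) := by fun_prop
    have h := lintegral_map (μ := (volume : Measure ℂ)) hm (measurable_const_smul (Real.exp (-((n : ℝ) / 2))))
    rw [← h, Measure.map_addHaar_smul _ (Real.exp_pos _).ne', lintegral_smul_measure, smul_eq_mul]
    congr 2
    rw [Complex.finrank_real_complex, ← Real.exp_nat_mul, ← Real.exp_neg, abs_of_pos (Real.exp_pos _)]
    congr 1
    push_cast; ring
  calc fockNormP 1 p (fun z => z ^ n) ≤ ∫⁻ z : ℂ, ENNReal.ofReal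
        (Real.exp ((n : ℝ) ^ 2 / 4) ^ p * (16 * Real.exp 4) ^ p) *
        ENNReal.ofReal ((1 + ‖Real.exp (-((n : ℝ) / 2)) • z‖) ^ (-(4 * p))) := by
        unfold fockNormP
        refine lintegral_mono fun z => ?_
        rw [← ENNReal.ofReal_mul (by positivity)]
        refine ENNReal.ofReal_le_ofReal ?_
        refine (Real.rpow_le_rpow (by positivity) (test_upper n z) (by linarith)).trans (le_of_eq ?_)
        rw [Real.mul_rpow (by positivity) (by positivity), Real.mul_rpow (by positivity) (by positivity),
          ← Real.rpow_mul (by positivity)]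
        ring_nf
    _ = ENNReal.ofReal (Real.exp ((n : ℝ) ^ 2 / 4) ^ p * (16 * Real.exp 4) ^ p) *
        (ENNReal.ofReal (Real.exp n) * I) := by
        rw [lintegral_const_mul' _ _ (by simp), hsc]
    _ ≤ ENNReal.ofReal (Real.exp ((n : ℝ) ^ 2 / 4) ^ p * (16 * Real.exp 4) ^ p) *
        (ENNReal.ofReal (Real.exp n) * ENNReal.ofReal (I.toReal + 1)) := by
        gcongr
        exact ENNReal.le_ofReal_iff_toReal_le hI.ne (by positivity) |>.mpr (by linarith)
    _ = _ := by
        rw [← ENNReal.ofReal_mul (by positivity), ← ENNReal.ofReal_mul (by positivity)]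
        congr 1
        ring

def annIdx (z : ℂ) : ℕ := ⌊2 * logPlus ‖z‖⌋₊

lemma annIdx_spec (z : ℂ) : (annIdx z : ℝ) ≤ 2 * logPlus ‖z‖ ∧ 2 * logPlus ‖z‖ < annIdx z + 1 := by
  have hs0 : 0 ≤ logPlus ‖z‖ := le_max_right _ _
  exact ⟨Nat.floor_le (by positivity), Nat.lt_floor_add_one _⟩

lemma test_lower (p : ℝ) (hp : 1 ≤ p) (z : ℂ) (n : ℕ) (hn : annIdx z = n) :
    Real.exp n * Real.exp ((n : ℝ) ^ 2 / 4) ^ p * Real.exp (-(1 / 4)) ^ p ≤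
      (1 + ‖z‖) ^ 2 * (‖z ^ n‖ * Real.exp (-(phi 1 z))) ^ p := by
  obtain ⟨h1, h2⟩ := annIdx_spec z
  rw [hn] at h1 h2
  have h3 := exp_logPlus_le z
  set s := logPlus ‖z‖ with hs
  have hs0 : 0 ≤ s := le_max_right _ _
  have h4 : ‖z ^ n‖ = Real.exp (n * s) := by
    rcases hs0.eq_or_lt with h | h
    · have : n = 0 := by
        rw [← h] at h1
        have : (n : ℝ) ≤ 0 := by linarith
        exact_mod_cast le_antisymm this (by positivity)
      subst this; simp
    · rw [norm_pow, Real.exp_nat_mul, exp_logPlus_of_pos z h]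
  rw [mul_assoc, ← Real.mul_rpow (by positivity) (by positivity)]
  gcongr ?_ * ?_
  · calc Real.exp n ≤ Real.exp ((2 : ℕ) * s) := by gcongr; push_cast; exact h1
      _ = Real.exp s ^ 2 := by rw [Real.exp_nat_mul]
      _ ≤ _ := by gcongr
  · refine Real.rpow_le_rpow (by positivity) ?_ (by linarith)
    rw [h4, ← Real.exp_add, ← Real.exp_add, Real.exp_le_exp]
    simp only [phi, ← hs]
    nlinarith

lemma sep_of_inj (S : Set ℂ) (hpar : ∀ a ∈ S, ∀ b ∈ S, a ≠ b → annIdx a < annIdx b →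
    annIdx a + 2 ≤ annIdx b) (hne : ∀ a ∈ S, ∀ b ∈ S, a ≠ b → annIdx a ≠ annIdx b) :
    DRhoSeparated1 S := by
  have main : ∀ a b : ℂ, annIdx a + 2 ≤ annIdx b → 1 / 4 ≤ ‖a - b‖ / (1 + min (rho1 a) (rho1 b)) := by
    intro a b hab
    have hs1 : 1 ≤ Real.sqrt 2 := by
      rw [Real.one_le_sqrt]; norm_num
    have hra : rho1 a ≤ ‖a‖ := div_le_self (norm_nonneg _) hs1
    have hr0 : ∀ x, 0 ≤ rho1 x := fun x => by unfold rho1; positivity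
    have hmin0 : 0 ≤ min (rho1 a) (rho1 b) := le_min (hr0 a) (hr0 b)
    have hmin : min (rho1 a) (rho1 b) ≤ ‖a‖ := (min_le_left _ _).trans hra
    obtain ⟨h1, h2⟩ := annIdx_spec a
    obtain ⟨h3, h4⟩ := annIdx_spec b
    have hab' : (annIdx a : ℝ) + 2 ≤ annIdx b := by exact_mod_cast hab
    have hs0 : 0 ≤ logPlus ‖a‖ := le_max_right _ _
    have hb := exp_logPlus_of_pos b (by linarith)
    have hgap : logPlus ‖a‖ + 1 / 2 ≤ logPlus ‖b‖ := by linarith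
    have h5 : Real.exp (logPlus ‖a‖) * (3 / 2) ≤ ‖b‖ := by
      rw [hb]
      refine le_trans ?_ (Real.exp_le_exp.mpr hgap)
      rw [Real.exp_add]
      gcongr
      have := Real.add_one_le_exp (1 / 2 : ℝ)
      linarith
    have h6 := norm_le_exp_logPlus a
    have h7 : 1 ≤ Real.exp (logPlus ‖a‖) := Real.one_le_exp hs0
    have h8 : ‖b‖ - ‖a‖ ≤ ‖a - b‖ := by rw [norm_sub_rev]; exact norm_sub_norm_le _ _
    rw [le_div_iff₀ (by linarith)]
    linarith
  refine ⟨1 / 4, by norm_num, fun a ha b hb hab => ?_⟩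
  rcases lt_or_gt_of_ne (hne a ha b hb hab) with h | h
  · exact main a b (hpar a ha b hb hab h)
  · have := main b a (hpar b hb a ha hab.symm h)
    unfold dRho1
    rwa [norm_sub_rev, min_comm]

lemma dir1 (p : ℝ) (hp : 1 ≤ p) (Λ : Set ℂ)
    (h : ∃ C : ℝ, 0 < C ∧ ∀ f : ℂ → ℂ, MemFock 1 p f →
      (∑' lam : Λ, ENNReal.ofReal
          ((1 + ‖(lam : ℂ)‖) ^ 2 *
            (‖f (lam : ℂ)‖ * Real.exp (-(phi 1 (lam : ℂ)))) ^ p)) ≤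
        ENNReal.ofReal C * fockNormP 1 p f) :
    ∃ (m : ℕ) (Λs : Fin m → Set ℂ), (∀ i, DRhoSeparated1 (Λs i)) ∧ Λ = ⋃ i, Λs i := by
  obtain ⟨C, hC, hCf⟩ := h
  obtain ⟨B, hB, hBn⟩ := test_norm p hp
  obtain ⟨N, hN⟩ := exists_nat_ge (C * B / Real.exp (-(1 / 4)) ^ p)
  let S : ℕ → Set ℂ := fun n => {z | z ∈ Λ ∧ annIdx z = n}
  have hcard : ∀ n, (S n).encard ≤ N := by
    intro n
    have hmem : MemFock 1 p (fun z => z ^ n) :=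
      ⟨by fun_prop, (hBn n).trans_lt ENNReal.ofReal_lt_top⟩
    have h1 := hCf _ hmem
    set A : ℝ := Real.exp n * Real.exp ((n : ℝ) ^ 2 / 4) ^ p with hA
    have hApos : 0 < A := by positivity
    have h2 : ((S n).encard : ℝ≥0∞) * ENNReal.ofReal (A * Real.exp (-(1 / 4)) ^ p) ≤
        ENNReal.ofReal (C * (B * A)) := by
      calc _ = ∑' _ : S n, ENNReal.ofReal (A * Real.exp (-(1 / 4)) ^ p) := by
            rw [ENNReal.tsum_set_const]
        _ ≤ ∑' lam : S n, ENNReal.ofReal ((1 + ‖(lam : ℂ)‖) ^ 2 *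
            (‖(lam : ℂ) ^ n‖ * Real.exp (-(phi 1 (lam : ℂ)))) ^ p) :=
            ENNReal.tsum_le_tsum fun l => ENNReal.ofReal_le_ofReal (test_lower p hp l n l.2.2)
        _ ≤ ∑' lam : Λ, ENNReal.ofReal ((1 + ‖(lam : ℂ)‖) ^ 2 *
            (‖(lam : ℂ) ^ n‖ * Real.exp (-(phi 1 (lam : ℂ)))) ^ p) :=
            ENNReal.tsum_mono_subtype (fun lam : ℂ => ENNReal.ofReal ((1 + ‖(lam : ℂ)‖) ^ 2 *
            (‖(lam : ℂ) ^ n‖ * Real.exp (-(phi 1 (lam : ℂ)))) ^ p)) (fun z hz => hz.1)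
        _ ≤ _ := h1
        _ ≤ _ := by
            rw [ENNReal.ofReal_mul hC.le]
            gcongr
            exact hBn n
    have h3 : ((S n).encard : ℝ≥0∞) ≤ (N : ℝ≥0∞) := by
      rw [← ENNReal.le_div_iff_mul_le (by left; simp; positivity) (by left; simp),
        ← ENNReal.ofReal_div_of_pos (by positivity)] at h2
      refine h2.trans ?_
      rw [← ENNReal.ofReal_natCast]
      refine ENNReal.ofReal_le_ofReal (le_trans (le_of_eq ?_) hN)
      field_simp
    exact_mod_cast h3
  have hfin : ∀ n, (S n).Finite := fun n => Set.finite_of_encard_le_coe (hcard n)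
  have hlab : ∀ n, ∃ e : ℂ → ℕ, Set.InjOn e (S n) ∧ ∀ z ∈ S n, e z < N := by
    intro n
    have h1 : (S n).encard ≤ (Finset.range N : Set ℕ).encard := by
      refine (hcard n).trans (le_of_eq ?_)
      rw [Set.encard_coe_eq_coe_finsetCard, Finset.card_range]
    obtain ⟨e, he1, he2⟩ := (hfin n).exists_injOn_of_encard_le h1
    exact ⟨e, he2, fun z hz => by simpa using he1 hz⟩
  choose e he1 he2 using hlab
  refine ⟨2 * N, fun i => {z | z ∈ Λ ∧ 2 * e (annIdx z) z + annIdx z % 2 = i}, fun i => ?_, ?_⟩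
  · refine sep_of_inj _ ?_ ?_
    · rintro a ⟨_, ha⟩ b ⟨_, hb⟩ _ hlt
      omega
    · rintro a ⟨ha0, ha⟩ b ⟨hb0, hb⟩ hab heq
      refine hab (he1 (annIdx a) ⟨ha0, rfl⟩ ⟨hb0, heq.symm⟩ ?_)
      rw [← heq] at hb
      omega
  · ext z
    simp only [Set.mem_iUnion, Set.mem_ofPred_eq]
    constructor
    · intro hz
      have := he2 (annIdx z) z ⟨hz, rfl⟩
      exact ⟨⟨2 * e (annIdx z) z + annIdx z % 2, by omega⟩, hz, rfl⟩
    · rintro ⟨_, hz, _⟩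
      exact hz

/-- the Carleson-type embedding
`Σ_{λ∈Λ} (1+|λ|)² |f(λ)e^{-φ(λ)}|^p ≤ C ‖f‖_{p,φ}^p` for all `f ∈ F^p_φ`
holds iff `Λ` is a finite union of `d_ρ`-separated sets. -/
theorem statement15 (p : ℝ) (hp : 1 ≤ p) (Λ : Set ℂ) (hΛ : Λ.Countable) :
    (∃ C : ℝ, 0 < C ∧ ∀ f : ℂ → ℂ, MemFock 1 p f →
      (∑' lam : Λ, ENNReal.ofReal
          ((1 + ‖(lam : ℂ)‖) ^ 2 *
            (‖f (lam : ℂ)‖ * Real.exp (-(phi 1 (lam : ℂ)))) ^ p)) ≤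
        ENNReal.ofReal C * fockNormP 1 p f) ↔
      (∃ (m : ℕ) (Λs : Fin m → Set ℂ),
        (∀ i, DRhoSeparated1 (Λs i)) ∧ Λ = ⋃ i, Λs i) := by
  exact ⟨dir1 p hp Λ, dir2 p hp Λ hΛ⟩

end
end
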